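/- Let β be a real number and let n ≥ 2 be an integer. Then for all reals 0 < b₁ < b₂, the set {α ∈ (b₁,b₂) : limsup_{x→∞} π*_{α,β}(x)·(log x)²/x ≤ 1 − 1/n} has Lebesgue measure zero. -/

import Mathlib

open MeasureTheory Filter

/-- `piStar α β x` counts the primes `p ≤ x` such that `⌊α p + β⌋` is also prime. -/
noncomputable def piStar (α β x : ℝ) : ℕ :=
  {p : ℕ | p.Prime ∧ (p : ℝ) ≤ x ∧ Nat.Prime (⌊α * p + β⌋).toNat}.ncard

section PrimeNumberTheorem
open Topology Set Chebyshev ArithmeticFunction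

/-- The Dirichlet series of `Λ` minus its polar part extends continuously to `1 ≤ re s`. -/
lemma exists_continuousOn_LSeries_vonMangoldt_sub_pole :
    ∃ F : ℂ → ℂ, ContinuousOn F {s | 1 ≤ s.re} ∧
      ∀ s : ℂ, 1 < s.re → LSeries (fun n => (Λ n : ℂ)) s = F s + 1 / (s - 1) := by
  refine ⟨vonMangoldt.LFunctionResidueClassAux (0 : ZMod 1),
    vonMangoldt.continuousOn_LFunctionResidueClassAux _, fun s hs => ?_⟩
  have h := vonMangoldt.eqOn_LFunctionResidueClassAux (q := 1) (a := 0)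
    (isUnit_of_subsingleton _) hs
  simp only at h
  rw [h]
  have : (fun n => ((vonMangoldt.residueClass (0 : ZMod 1) n : ℝ) : ℂ)) = fun n => (Λ n : ℂ) := by
    ext n
    rw [vonMangoldt.residueClass, indicator_of_mem]
    exact Subsingleton.elim _ _
  rw [this]
  simp

lemma psi_isBigO_id : (fun n : ℕ => ∑ k ∈ Finset.Icc 1 n, Λ k) =O[atTop]
    fun n => (n : ℝ) ^ (1 : ℝ) := by
  refine Asymptotics.IsBigO.of_bound (Real.log 4 + 4) (Eventually.of_forall fun n => ?_)
  have h := psi_le_const_mul_self (x := n) (Nat.cast_nonneg n)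
  have h0 := psi_nonneg (n : ℝ)
  have : ψ (n : ℝ) = ∑ k ∈ Finset.Icc 1 n, Λ k := by
    rw [psi, Nat.floor_natCast]; rfl
  rw [this] at h h0
  rw [Real.norm_of_nonneg h0, Real.rpow_one, Real.norm_of_nonneg (Nat.cast_nonneg n)]
  exact h

/-- The normalised Chebyshev function in logarithmic scale. -/
noncomputable def psiExp (u : ℝ) : ℝ := ψ (Real.exp u) * Real.exp (-u)

lemma psiExp_nonneg (u : ℝ) : 0 ≤ psiExp u :=
  mul_nonneg (psi_nonneg _) (Real.exp_pos _).le

lemma psiExp_le (u : ℝ) : psiExp u ≤ Real.log 4 + 4 := by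
  have h := psi_le_const_mul_self (x := Real.exp u) (Real.exp_pos _).le
  rw [psiExp, Real.exp_neg, ← div_eq_mul_inv, div_le_iff₀ (Real.exp_pos _)]
  exact h

lemma psiExp_of_nonpos {u : ℝ} (hu : u ≤ 0) : psiExp u = 0 := by
  rw [psiExp, psi_eq_zero_of_le_one (Real.exp_le_one_iff.2 hu), zero_mul]

lemma measurable_psiExp : Measurable psiExp :=
  ((psi_mono.measurable).comp Real.measurable_exp).mul (Real.measurable_exp.comp measurable_neg)

lemma psiExp_le_exp_mul {u v : ℝ} (h : u ≤ v) : psiExp u ≤ Real.exp (v - u) * psiExp v := by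
  have := psi_mono (Real.exp_le_exp.2 h)
  rw [psiExp, psiExp]
  calc _ ≤ ψ (Real.exp v) * Real.exp (-u) := by gcongr
    _ = _ := by rw [show -u = (v - u) + -v by ring, Real.exp_add]; ring

lemma integral_psiExp_mul_exp {w : ℂ} (hw : 0 < w.re) :
    ∫ u in Ioi (0:ℝ), (psiExp u : ℂ) * Complex.exp (-w * u) =
      LSeries (fun n => (Λ n : ℂ)) (1 + w) / (1 + w) := by
  have hs : (1:ℝ) < (1 + w).re := by simp [hw]
  have hne : (1 + w) ≠ 0 := by
    intro h; rw [h] at hs; norm_num at hs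
  rw [LSeries_eq_mul_integral_of_nonneg _ zero_le_one hs psi_isBigO_id
    (fun n => vonMangoldt_nonneg), mul_div_cancel_left₀ _ hne]
  have himg : Real.exp '' Ioi 0 = Ioi 1 := by
    ext y; constructor
    · rintro ⟨x, hx, rfl⟩; exact Real.one_lt_exp_iff.2 hx
    · intro hy
      exact ⟨Real.log y, Real.log_pos hy, Real.exp_log (zero_lt_one.trans hy)⟩
  rw [← himg, integral_image_eq_integral_abs_deriv_smul measurableSet_Ioi
    (fun x _ => (Real.hasDerivAt_exp x).hasDerivWithinAt) Real.exp_injective.injOn]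
  refine setIntegral_congr_fun measurableSet_Ioi fun u _ => ?_
  have h1 : (∑ k ∈ Finset.Icc 1 ⌊Real.exp u⌋₊, (Λ k : ℂ)) = ((ψ (Real.exp u) : ℝ) : ℂ) := by
    rw [psi]; push_cast; rfl
  rw [h1, psiExp, abs_of_pos (Real.exp_pos _), Complex.real_smul,
    Complex.cpow_def_of_ne_zero (by exact_mod_cast (Real.exp_pos u).ne'),
    ← Complex.ofReal_log (Real.exp_pos u).le, Real.log_exp]
  push_cast
  rw [mul_assoc, ← Complex.exp_add, mul_left_comm, ← Complex.exp_add]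
  ring_nf

lemma integrableOn_psiExp_sub_one_mul_exp {w : ℂ} (hw : 0 < w.re) :
    IntegrableOn (fun u : ℝ => ((psiExp u - 1 : ℝ) : ℂ) * Complex.exp (-w * u)) (Ioi 0) := by
  have h : IntegrableOn (fun u : ℝ => Complex.exp (-w * u)) (Ioi 0) :=
    integrableOn_exp_mul_complex_Ioi (by simpa using hw) 0
  refine h.bdd_mul (c := Real.log 4 + 5) ?_ (ae_of_all _ fun u => ?_)
  · exact (Complex.measurable_ofReal.comp (measurable_psiExp.sub_const 1)).aestronglyMeasurable
  · rw [Complex.norm_real, Real.norm_eq_abs, abs_le]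
    constructor <;> linarith [psiExp_nonneg u, psiExp_le u,
      Real.log_nonneg (show (1 : ℝ) ≤ 4 by norm_num)]

lemma integral_psiExp_sub_one_mul_exp {F : ℂ → ℂ}
    (hF : ∀ s : ℂ, 1 < s.re → LSeries (fun n => (Λ n : ℂ)) s = F s + 1 / (s - 1))
    {w : ℂ} (hw : 0 < w.re) :
    ∫ u in Ioi (0:ℝ), ((psiExp u - 1 : ℝ) : ℂ) * Complex.exp (-w * u) =
      (F (1 + w) - 1) / (1 + w) := by
  have h : IntegrableOn (fun u : ℝ => Complex.exp (-w * u)) (Ioi 0) :=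
    integrableOn_exp_mul_complex_Ioi (by simpa using hw) 0
  have h1 := integrableOn_psiExp_sub_one_mul_exp hw
  have h2 : IntegrableOn (fun u : ℝ => (psiExp u : ℂ) * Complex.exp (-w * u)) (Ioi 0) := by
    refine (h1.add h).congr (ae_of_all _ fun u => ?_)
    simp only [Pi.add_apply]
    push_cast
    ring
  have e : ∀ u : ℝ, ((psiExp u - 1 : ℝ) : ℂ) * Complex.exp (-w * u) =
      (psiExp u : ℂ) * Complex.exp (-w * u) - Complex.exp (-w * u) := by
    intro u; push_cast; ring
  simp_rw [e]
  rw [integral_sub h2 h, integral_psiExp_mul_exp hw,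
    integral_exp_mul_complex_Ioi (by simpa using hw) 0, hF _ (by simp [hw])]
  have hw0 : w ≠ 0 := by intro h0; simp [h0] at hw
  have hne : (1 + w) ≠ 0 := by
    intro h0
    have := congrArg Complex.re h0
    simp at this; linarith
  simp only [Complex.ofReal_zero, mul_zero, Complex.exp_zero, add_sub_cancel_left]
  field_simp
  ring

/-- The (unnormalised) Fejér kernel. -/
noncomputable def fejer (y : ℝ) : ℝ := if y = 0 then 1 else 2 * (1 - Real.cos y) / y ^ 2

lemma fejer_nonneg (y : ℝ) : 0 ≤ fejer y := by
  unfold fejer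
  split_ifs
  · exact zero_le_one
  · have := Real.cos_le_one y
    have : 0 ≤ 1 - Real.cos y := by linarith
    positivity

lemma fejer_le (y : ℝ) : fejer y ≤ 5 * (1 + y ^ 2)⁻¹ := by
  rw [← div_eq_mul_inv, le_div_iff₀ (by positivity)]
  unfold fejer
  split_ifs with h
  · simp [h]
  · have hy : 0 < y ^ 2 := by positivity
    have h1 := Real.one_sub_sq_div_two_le_cos (x := y)
    have h2 := Real.neg_one_le_cos y
    rw [div_mul_eq_mul_div, div_le_iff₀ hy]
    nlinarith

lemma measurable_fejer : Measurable fejer := by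
  unfold fejer
  refine Measurable.ite (measurableSet_eq) measurable_const ?_
  fun_prop

lemma integrable_fejer : Integrable fejer := by
  refine (integrable_inv_one_add_sq.const_mul 5).mono' measurable_fejer.aestronglyMeasurable
    (ae_of_all _ fun y => ?_)
  rw [Real.norm_of_nonneg (fejer_nonneg y)]
  exact fejer_le y

lemma integral_fejer_pos : 0 < ∫ y, fejer y := by
  rw [integral_pos_iff_support_of_nonneg fejer_nonneg integrable_fejer]
  refine lt_of_lt_of_le ?_ (measure_mono (s := Ioo 0 1) fun y hy => ?_)
  · simp
  · have hc : Real.cos y < 1 := by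
      rw [← Real.cos_zero]
      exact Real.cos_lt_cos_of_nonneg_of_le_pi_div_two le_rfl
        (by linarith [hy.2, Real.pi_gt_three]) hy.1
    have : y ≠ 0 := hy.1.ne'
    rw [Function.mem_support, fejer, if_neg this]
    have : 0 < 1 - Real.cos y := by linarith
    have := hy.1
    positivity

lemma integral_triangle_mul_exp (y : ℝ) :
    ∫ t in (-1:ℝ)..1, ((1 - |t| : ℝ) : ℂ) * Complex.exp (Complex.I * (t * y : ℝ)) = fejer y := by
  have hcont : Continuous fun t : ℝ =>
      ((1 - |t| : ℝ) : ℂ) * Complex.exp (Complex.I * (t * y : ℝ)) := by fun_prop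
  have hr : ∫ t in (0:ℝ)..1, 2 * ((1 - t) * Real.cos (t * y)) = fejer y := by
    unfold fejer
    split_ifs with h
    · subst h
      simp only [mul_zero, Real.cos_zero, mul_one, intervalIntegral.integral_const_mul]
      rw [intervalIntegral.integral_sub (by simp) (by simp)]
      norm_num
    · have hd : ∀ t ∈ uIcc (0:ℝ) 1, HasDerivAt
          (fun t => 2 * ((1 - t) * Real.sin (t * y) / y - Real.cos (t * y) / y ^ 2))
          (2 * ((1 - t) * Real.cos (t * y))) t := by
        intro t _
        have h1 : HasDerivAt (fun t : ℝ => t * y) y t := by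
          simpa using (hasDerivAt_id t).mul_const y
        have h2 := (((hasDerivAt_id t).const_sub 1).mul h1.sin).div_const y
        have h3 := (h1.cos).div_const (y ^ 2)
        refine ((h2.sub h3).const_mul 2).congr_deriv ?_
        simp only [id]
        field_simp
        ring
      rw [intervalIntegral.integral_eq_sub_of_hasDerivAt hd
        (Continuous.intervalIntegrable (by fun_prop) _ _)]
      simp
      field_simp
      ring
  rw [← intervalIntegral.integral_add_adjacent_intervals (b := 0)
    (hcont.intervalIntegrable _ _) (hcont.intervalIntegrable _ _), ← hr,
    ← intervalIntegral.integral_ofReal]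
  have hneg := intervalIntegral.integral_comp_neg (a := 0) (b := 1) (fun t : ℝ =>
    ((1 - |t| : ℝ) : ℂ) * Complex.exp (Complex.I * (t * y : ℝ)))
  rw [neg_zero] at hneg
  rw [← hneg]
  refine (intervalIntegral.integral_add ((hcont.comp continuous_neg).intervalIntegrable _ _)
    (hcont.intervalIntegrable _ _)).symm.trans ?_
  refine intervalIntegral.integral_congr fun t ht => ?_
  rw [uIcc_of_le zero_le_one] at ht
  simp only [Function.comp_apply, abs_neg, abs_of_nonneg ht.1]
  rw [← mul_add]
  have := Complex.two_cos (t * y : ℝ)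
  push_cast at this ⊢
  rw [mul_left_comm 2, this]
  congr 1
  rw [add_comm]
  congr 2 <;> ring

lemma fejer_eq_integral (l v u : ℝ) :
    ((fejer (l * (v - u)) : ℝ) : ℂ) = ∫ t in (-1:ℝ)..1,
      ((1 - |t| : ℝ) : ℂ) * Complex.exp (Complex.I * (t * l * v : ℝ)) *
        Complex.exp (-(Complex.I * (t * l * u : ℝ))) := by
  rw [← integral_triangle_mul_exp]
  refine intervalIntegral.integral_congr fun t _ => ?_
  rw [mul_assoc, ← Complex.exp_add]
  congr 2
  push_cast
  ring

lemma integral_psiExp_sub_one_mul_exp_mul_fejer {F : ℂ → ℂ}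
    (hF : ∀ s : ℂ, 1 < s.re → LSeries (fun n => (Λ n : ℂ)) s = F s + 1 / (s - 1))
    (l v : ℝ) {σ : ℝ} (hσ : 0 < σ) :
    ∫ u in Ioi (0:ℝ), ((psiExp u - 1 : ℝ) : ℂ) * Complex.exp (-σ * u) * fejer (l * (v - u)) =
      ∫ t in (-1:ℝ)..1, ((1 - |t| : ℝ) : ℂ) * Complex.exp (Complex.I * (t * l * v : ℝ)) *
        ((F (1 + (σ + Complex.I * (t * l : ℝ))) - 1) / (1 + (σ + Complex.I * (t * l : ℝ)))) := by
  have hre : ∀ t : ℝ, (σ + Complex.I * (t * l : ℝ)).re = σ := by intro t; simp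
  have hfi : Integrable (Function.uncurry fun (u t : ℝ) =>
      (((psiExp u - 1 : ℝ) : ℂ) * Complex.exp (-σ * u)) *
      (((1 - |t| : ℝ) : ℂ) * Complex.exp (Complex.I * (t * l * v : ℝ)) *
        Complex.exp (-(Complex.I * (t * l * u : ℝ)))))
      ((volume.restrict (Ioi 0)).prod (volume.restrict (Ioc (-1) 1))) := by
    have h1 : IntegrableOn (fun u : ℝ => ((psiExp u - 1 : ℝ) : ℂ) * Complex.exp (-σ * u)) (Ioi 0) :=
      integrableOn_psiExp_sub_one_mul_exp (w := (σ : ℂ)) (by simpa using hσ)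
    have h2 : IntegrableOn (fun t : ℝ => ((1 - |t| : ℝ) : ℂ)) (Ioc (-1) 1) :=
      ((Continuous.integrableOn_Icc (by fun_prop)).mono_set Ioc_subset_Icc_self)
    have h3 := h1.mul_prod h2
    refine (h3.bdd_mul (c := 1) (f := fun p : ℝ × ℝ =>
      Complex.exp (Complex.I * (p.2 * l * v : ℝ)) * Complex.exp (-(Complex.I * (p.2 * l * p.1 : ℝ))))
      (Continuous.aestronglyMeasurable (by fun_prop)) (ae_of_all _ fun p => ?_)).congr
        (ae_of_all _ fun p => ?_)
    · rw [norm_mul, mul_comm Complex.I, mul_comm Complex.I, ← neg_mul, ← Complex.ofReal_neg,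
        Complex.norm_exp_ofReal_mul_I, Complex.norm_exp_ofReal_mul_I, mul_one]
    · simp only [Function.uncurry]
      ring
  simp_rw [fejer_eq_integral, ← intervalIntegral.integral_const_mul]
  simp_rw [intervalIntegral.integral_of_le (show (-1:ℝ) ≤ 1 by norm_num)]
  rw [integral_integral_swap hfi]
  refine integral_congr_ae (ae_of_all _ fun t => ?_)
  simp only
  rw [← integral_psiExp_sub_one_mul_exp hF (by rw [hre]; exact hσ), ← integral_const_mul]
  refine integral_congr_ae (ae_of_all _ fun u => ?_)
  simp only
  have : Complex.exp (-(σ + Complex.I * (t * l : ℝ)) * u) =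
      Complex.exp (-σ * u) * Complex.exp (-(Complex.I * (t * l * u : ℝ))) := by
    rw [← Complex.exp_add]; congr 1; push_cast; ring
  rw [this]
  ring

lemma abs_psiExp_sub_one_le (u : ℝ) : |psiExp u - 1| ≤ Real.log 4 + 5 := by
  rw [abs_le]
  constructor <;> linarith [psiExp_nonneg u, psiExp_le u,
      Real.log_nonneg (show (1 : ℝ) ≤ 4 by norm_num)]

lemma integrable_fejer_comp {l : ℝ} (hl : 0 < l) (v : ℝ) :
    Integrable fun u => fejer (l * (v - u)) :=
  (integrable_fejer.comp_mul_left' hl.ne').comp_sub_left v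

lemma integrable_psiExp_sub_one_mul_fejer {l : ℝ} (hl : 0 < l) (v : ℝ) :
    Integrable fun u => (psiExp u - 1) * fejer (l * (v - u)) :=
  (integrable_fejer_comp hl v).bdd_mul (c := Real.log 4 + 5)
    (measurable_psiExp.sub_const 1).aestronglyMeasurable
    (ae_of_all _ fun u => abs_psiExp_sub_one_le u)

lemma integral_psiExp_sub_one_mul_fejer {F : ℂ → ℂ} (hFc : ContinuousOn F {s | 1 ≤ s.re})
    (hF : ∀ s : ℂ, 1 < s.re → LSeries (fun n => (Λ n : ℂ)) s = F s + 1 / (s - 1))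
    {l : ℝ} (hl : 0 < l) (v : ℝ) :
    ((∫ u in Ioi (0:ℝ), (psiExp u - 1) * fejer (l * (v - u)) : ℝ) : ℂ) =
      ∫ t in (-1:ℝ)..1, ((1 - |t| : ℝ) : ℂ) * Complex.exp (Complex.I * (t * l * v : ℝ)) *
        ((F (1 + Complex.I * (t * l : ℝ)) - 1) / (1 + Complex.I * (t * l : ℝ))) := by
  have hL : Tendsto (fun σ : ℝ => ∫ u in Ioi (0:ℝ),
      ((psiExp u - 1 : ℝ) : ℂ) * Complex.exp (-σ * u) * fejer (l * (v - u))) (𝓝[>] 0)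
      (𝓝 (∫ u in Ioi (0:ℝ), ((psiExp u - 1 : ℝ) : ℂ) * fejer (l * (v - u)))) := by
    refine tendsto_integral_filter_of_dominated_convergence
      (fun u => ‖(psiExp u - 1) * fejer (l * (v - u))‖) ?_ ?_
      (integrable_psiExp_sub_one_mul_fejer hl v).norm.integrableOn ?_
    · refine Eventually.of_forall fun σ => Measurable.aestronglyMeasurable ?_
      have := measurable_psiExp
      have := measurable_fejer
      fun_prop
    · filter_upwards [self_mem_nhdsWithin] with σ hσ
      refine (ae_restrict_mem measurableSet_Ioi).mono fun u hu => ?_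
      have : ‖Complex.exp (-σ * u)‖ ≤ 1 := by
        rw [Complex.norm_exp]
        simp only [neg_mul, Complex.neg_re, Complex.mul_re, Complex.ofReal_re, Complex.ofReal_im,
          mul_zero, sub_zero, Real.exp_le_one_iff, Left.neg_nonpos_iff]
        exact (mul_pos hσ hu).le
      rw [norm_mul, norm_mul, norm_mul, Complex.norm_real, Complex.norm_real]
      calc _ ≤ ‖psiExp u - 1‖ * 1 * ‖fejer (l * (v - u))‖ := by gcongr
        _ = _ := by rw [mul_one]
    · refine ae_of_all _ fun u => ?_
      have : Continuous fun σ : ℝ =>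
        ((psiExp u - 1 : ℝ) : ℂ) * Complex.exp (-σ * u) * fejer (l * (v - u)) := by fun_prop
      have h0 := (this.tendsto 0).mono_left (nhdsWithin_le_nhds (s := Ioi 0))
      simpa using h0
  have hG : Continuous (Function.uncurry fun (σ t : ℝ) =>
      ((1 - |t| : ℝ) : ℂ) * Complex.exp (Complex.I * (t * l * v : ℝ)) *
        ((F (1 + ((max σ 0 : ℝ) + Complex.I * (t * l : ℝ))) - 1) /
          (1 + ((max σ 0 : ℝ) + Complex.I * (t * l : ℝ))))) := by
    have hre : ∀ p : ℝ × ℝ, 1 ≤ (1 + ((max p.1 0 : ℝ) + Complex.I * (p.2 * l : ℝ))).re := by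
      intro p; simp
    simp only [Function.uncurry_def]
    refine Continuous.mul (by fun_prop) (Continuous.div (Continuous.sub ?_ continuous_const)
      (by fun_prop) fun p h0 => ?_)
    · exact hFc.comp_continuous (by fun_prop) hre
    · have := hre p
      rw [h0] at this; norm_num at this
  have hR := (intervalIntegral.continuous_parametric_intervalIntegral_of_continuous'
    (μ := volume) hG (-1) 1).tendsto 0
  replace hR := hR.mono_left (nhdsWithin_le_nhds (s := Ioi 0))
  have heq := hL.congr' (f₂ := _) (by
    filter_upwards [self_mem_nhdsWithin] with σ hσ
    exact integral_psiExp_sub_one_mul_exp_mul_fejer hF l v hσ)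
  have heq2 := hR.congr' (f₂ := fun σ : ℝ => ∫ t in (-1:ℝ)..1,
      ((1 - |t| : ℝ) : ℂ) * Complex.exp (Complex.I * (t * l * v : ℝ)) *
        ((F (1 + (σ + Complex.I * (t * l : ℝ))) - 1) / (1 + (σ + Complex.I * (t * l : ℝ))))) (by
    filter_upwards [self_mem_nhdsWithin] with σ hσ
    rw [max_eq_left (le_of_lt hσ)])
  have := tendsto_nhds_unique heq heq2
  simp only [max_self, Complex.ofReal_zero, zero_add] at this
  rw [← this, ← integral_complex_ofReal]
  refine integral_congr_ae (ae_of_all _ fun u => ?_)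
  simp

lemma tendsto_integral_psiExp_sub_one_mul_fejer {l : ℝ} (hl : 0 < l) :
    Tendsto (fun v : ℝ => ∫ u in Ioi (0:ℝ), (psiExp u - 1) * fejer (l * (v - u)))
      atTop (𝓝 0) := by
  obtain ⟨F, hFc, hF⟩ := exists_continuousOn_LSeries_vonMangoldt_sub_pole
  have hRL := Real.tendsto_integral_exp_smul_cocompact ((Ioc (-1:ℝ) 1).indicator fun t =>
    ((1 - |t| : ℝ) : ℂ) * ((F (1 + Complex.I * (t * l : ℝ)) - 1) / (1 + Complex.I * (t * l : ℝ))))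
  have hv : Tendsto (fun v : ℝ => -(l * v / (2 * Real.pi))) atTop (cocompact ℝ) := by
    refine Tendsto.mono_right ?_ atBot_le_cocompact
    refine tendsto_neg_atTop_atBot.comp (Tendsto.atTop_div_const (by positivity) ?_)
    exact tendsto_id.const_mul_atTop hl
  have h2 := hRL.comp hv
  suffices h : Tendsto (fun v : ℝ =>
      ((∫ u in Ioi (0:ℝ), (psiExp u - 1) * fejer (l * (v - u)) : ℝ) : ℂ)) atTop (𝓝 ((0:ℝ):ℂ)) from
    tendsto_ofReal_iff.1 h
  refine h2.congr fun v => ?_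
  rw [integral_psiExp_sub_one_mul_fejer hFc hF hl v,
    intervalIntegral.integral_of_le (by norm_num), ← integral_indicator measurableSet_Ioc]
  refine integral_congr_ae (ae_of_all _ fun t => ?_)
  simp only [indicator]
  split_ifs
  · rw [Circle.smul_def, Real.fourierChar_apply, smul_eq_mul]
    have : Complex.exp (2 * Real.pi * (-(t * -(l * v / (2 * Real.pi))) : ℝ) * Complex.I) =
      Complex.exp (Complex.I * (t * l * v : ℝ)) := by
      congr 1
      have : (Real.pi : ℂ) ≠ 0 := by exact_mod_cast Real.pi_ne_zero
      push_cast
      field_simp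
    push_cast at this ⊢
    rw [this]
    ring
  · simp

lemma integrable_fejer_mul {l : ℝ} (hl : 0 < l) : Integrable fun x => fejer (l * x) :=
  integrable_fejer.comp_mul_left' hl.ne'

lemma integrable_psiExp_mul_fejer {l : ℝ} (hl : 0 < l) (v : ℝ) :
    Integrable fun x => psiExp (v - x) * fejer (l * x) :=
  (integrable_fejer_mul hl).bdd_mul (c := Real.log 4 + 4)
    (measurable_psiExp.comp (measurable_const.sub measurable_id)).aestronglyMeasurable
    (ae_of_all _ fun u => by rw [Real.norm_of_nonneg (psiExp_nonneg _)]; exact psiExp_le _)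

lemma tendsto_integral_psiExp_mul_fejer {l : ℝ} (hl : 0 < l) :
    Tendsto (fun v : ℝ => ∫ x, psiExp (v - x) * fejer (l * x)) atTop
      (𝓝 (∫ x, fejer (l * x))) := by
  have h1 := tendsto_integral_psiExp_sub_one_mul_fejer hl
  have h2 : Tendsto (fun v : ℝ => ∫ x, (Iio v).indicator (fun x => fejer (l * x)) x) atTop
      (𝓝 (∫ x, fejer (l * x))) := by
    refine tendsto_integral_filter_of_dominated_convergence (fun x => fejer (l * x)) ?_ ?_
      (integrable_fejer_mul hl) ?_
    · exact Eventually.of_forall fun v =>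
        (integrable_fejer_mul hl).aestronglyMeasurable.indicator measurableSet_Iio
    · refine Eventually.of_forall fun v => ae_of_all _ fun x => ?_
      refine (norm_indicator_le_norm_self _ _).trans ?_
      rw [Real.norm_of_nonneg (fejer_nonneg _)]
    · refine ae_of_all _ fun x => tendsto_const_nhds.congr' ?_
      filter_upwards [eventually_gt_atTop x] with v hv
      rw [indicator_of_mem (show x ∈ Iio v from hv)]
  have h3 := h1.add h2
  rw [zero_add] at h3
  refine h3.congr fun v => ?_
  rw [← integral_sub_left_eq_self (fun x => (Iio v).indicator (fun x => fejer (l * x)) x) volume v,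
    ← integral_sub_left_eq_self (fun x => psiExp (v - x) * fejer (l * x)) volume v,
    ← integral_indicator measurableSet_Ioi, ← integral_add]
  · refine integral_congr_ae (ae_of_all _ fun u => ?_)
    simp only [sub_sub_cancel, indicator, mem_Ioi, mem_Iio, sub_lt_self_iff]
    split_ifs with h
    · ring
    · rw [psiExp_of_nonpos (not_lt.1 h)]; ring
  · exact (integrable_psiExp_sub_one_mul_fejer hl v).indicator measurableSet_Ioi
  · exact ((integrable_fejer_mul hl).indicator measurableSet_Iio).comp_sub_left v

lemma exists_fejer_concentrated {δ η : ℝ} (hδ : 0 < δ) (hη : 0 < η) :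
    ∃ l : ℝ, 0 < l ∧
      (1 - η) * (∫ x, fejer (l * x)) ≤ ∫ x in Icc (-δ) δ, fejer (l * x) := by
  have hI := integral_fejer_pos
  have ht : Tendsto (fun l : ℝ => ∫ x in (-(l * δ))..(l * δ), fejer x) atTop
      (𝓝 (∫ x, fejer x)) :=
    intervalIntegral_tendsto_integral integrable_fejer
      (tendsto_neg_atTop_atBot.comp (tendsto_id.atTop_mul_const hδ))
      (tendsto_id.atTop_mul_const hδ)
  have hev := ht.eventually (lt_mem_nhds (show (1 - η) * ∫ x, fejer x < ∫ x, fejer x by nlinarith))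
  obtain ⟨l, hl, hl0⟩ := (hev.and (eventually_gt_atTop 0)).exists
  refine ⟨l, hl0, ?_⟩
  rw [integral_Icc_eq_integral_Ioc, ← intervalIntegral.integral_of_le (by linarith),
    intervalIntegral.integral_comp_mul_left _ hl0.ne', Measure.integral_comp_mul_left,
    abs_of_pos (by positivity), smul_eq_mul, smul_eq_mul, mul_neg, mul_left_comm]
  gcongr

lemma eventually_psiExp_bounds {η : ℝ} (hη : 0 < η) (hη1 : η < 1) :
    ∀ᶠ v in atTop, psiExp v ≤ Real.exp (2 * η) * ((1 + η) / (1 - η)) ∧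
      Real.exp (-(2 * η)) * (1 - η - (Real.log 4 + 4) * η) ≤ psiExp v := by
  obtain ⟨l, hl, hc⟩ := exists_fejer_concentrated hη hη
  have hB : 0 < ∫ x, fejer (l * x) := by
    rw [Measure.integral_comp_mul_left, abs_of_pos (by positivity), smul_eq_mul]
    exact mul_pos (by positivity) integral_fejer_pos
  set B := ∫ x, fejer (l * x) with hBdef
  have hf := integrable_fejer_mul hl
  have ht := tendsto_integral_psiExp_mul_fejer hl
  have hlo := ht.eventually (lt_mem_nhds (show (1 - η) * B < B by nlinarith))
  have hhi := ht.eventually (gt_mem_nhds (show B < (1 + η) * B by nlinarith))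
  have hsplit : B = (∫ x in Icc (-η) η, fejer (l * x)) + ∫ x in (Icc (-η) η)ᶜ, fejer (l * x) :=
    (integral_add_compl measurableSet_Icc hf).symm
  have hup : ∀ᶠ v in atTop, psiExp (v - η) ≤ Real.exp (2 * η) * ((1 + η) / (1 - η)) := by
    filter_upwards [hhi] with v hv
    have h1 : (∫ x in Icc (-η) η, Real.exp (-(2 * η)) * psiExp (v - η) * fejer (l * x)) ≤
        ∫ x in Icc (-η) η, psiExp (v - x) * fejer (l * x) := by
      refine setIntegral_mono_on (hf.const_mul _).integrableOn
        (integrable_psiExp_mul_fejer hl v).integrableOn measurableSet_Icc fun x hx => ?_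
      refine mul_le_mul_of_nonneg_right ?_ (fejer_nonneg _)
      have h2 := psiExp_le_exp_mul (show v - η ≤ v - x by linarith [hx.2])
      calc _ ≤ Real.exp (-(2 * η)) * (Real.exp (v - x - (v - η)) * psiExp (v - x)) := by gcongr
        _ = Real.exp (-(η + x)) * psiExp (v - x) := by
          rw [← mul_assoc, ← Real.exp_add]; ring_nf
        _ ≤ 1 * psiExp (v - x) := by
          refine mul_le_mul_of_nonneg_right ?_ (psiExp_nonneg _)
          rw [Real.exp_le_one_iff]; linarith [hx.1]
        _ = _ := one_mul _
    have h2 : (∫ x in Icc (-η) η, psiExp (v - x) * fejer (l * x)) ≤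
        ∫ x, psiExp (v - x) * fejer (l * x) :=
      setIntegral_le_integral (integrable_psiExp_mul_fejer hl v)
        (ae_of_all _ fun x => mul_nonneg (psiExp_nonneg _) (fejer_nonneg _))
    rw [integral_const_mul] at h1
    have h3 : Real.exp (-(2 * η)) * psiExp (v - η) * ((1 - η) * B) ≤ (1 + η) * B := by
      refine le_trans ?_ (h1.trans (h2.trans hv.le))
      exact mul_le_mul_of_nonneg_left hc (mul_nonneg (Real.exp_pos _).le (psiExp_nonneg _))
    have h4 : Real.exp (-(2 * η)) * psiExp (v - η) * (1 - η) ≤ 1 + η := by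
      rw [← mul_assoc] at h3
      exact le_of_mul_le_mul_right h3 hB
    rw [Real.exp_neg, inv_mul_eq_div, div_mul_eq_mul_div, div_le_iff₀ (Real.exp_pos _)] at h4
    rw [mul_div_assoc', le_div_iff₀ (by linarith)]
    linarith
  have hdown : ∀ᶠ v in atTop, Real.exp (-(2 * η)) * (1 - η - (Real.log 4 + 4) * η) ≤
      psiExp (v + η) := by
    filter_upwards [hlo] with v hv
    have h1 : (∫ x in Icc (-η) η, psiExp (v - x) * fejer (l * x)) ≤
        ∫ x in Icc (-η) η, Real.exp (2 * η) * psiExp (v + η) * fejer (l * x) := by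
      refine setIntegral_mono_on (integrable_psiExp_mul_fejer hl v).integrableOn
        (hf.const_mul _).integrableOn measurableSet_Icc fun x hx => ?_
      refine mul_le_mul_of_nonneg_right ?_ (fejer_nonneg _)
      refine (psiExp_le_exp_mul (show v - x ≤ v + η by linarith [hx.1])).trans ?_
      refine mul_le_mul_of_nonneg_right ?_ (psiExp_nonneg _)
      rw [Real.exp_le_exp]; linarith [hx.2]
    have h2 : (∫ x in (Icc (-η) η)ᶜ, psiExp (v - x) * fejer (l * x)) ≤
        ∫ x in (Icc (-η) η)ᶜ, (Real.log 4 + 4) * fejer (l * x) :=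
      setIntegral_mono (integrable_psiExp_mul_fejer hl v).integrableOn
        (hf.const_mul _).integrableOn
        fun x => mul_le_mul_of_nonneg_right (psiExp_le _) (fejer_nonneg _)
    have h3 := integral_add_compl (μ := volume) (measurableSet_Icc (a := -η) (b := η))
      (integrable_psiExp_mul_fejer hl v)
    rw [integral_const_mul] at h1 h2
    have hC : 0 ≤ Real.log 4 + 4 := by
      linarith [Real.log_nonneg (show (1:ℝ) ≤ 4 by norm_num)]
    have h0 : 0 ≤ ∫ x in (Icc (-η) η)ᶜ, fejer (l * x) :=
      setIntegral_nonneg measurableSet_Icc.compl fun x _ => fejer_nonneg _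
    have h4 : (Real.log 4 + 4) * (∫ x in (Icc (-η) η)ᶜ, fejer (l * x)) ≤
        (Real.log 4 + 4) * (η * B) := by
      gcongr; linarith
    have h5 : Real.exp (2 * η) * psiExp (v + η) * (∫ x in Icc (-η) η, fejer (l * x)) ≤
        Real.exp (2 * η) * psiExp (v + η) * B :=
      mul_le_mul_of_nonneg_left (by linarith) (mul_nonneg (Real.exp_pos _).le (psiExp_nonneg _))
    have h6 : (1 - η - (Real.log 4 + 4) * η) * B ≤ Real.exp (2 * η) * psiExp (v + η) * B := by
      linarith
    have h7 := le_of_mul_le_mul_right h6 hB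
    rw [Real.exp_neg, inv_mul_le_iff₀ (Real.exp_pos _)]
    exact h7
  have e1 := (tendsto_atTop_add_const_right atTop η tendsto_id).eventually hup
  have e2 := (tendsto_atTop_add_const_right atTop (-η) tendsto_id).eventually hdown
  filter_upwards [e1, e2] with v h1 h2
  simp only [id, add_sub_cancel_right, neg_add_cancel_right] at h1 h2
  exact ⟨h1, h2⟩

lemma tendsto_psiExp : Tendsto psiExp atTop (𝓝 1) := by
  have hu : Tendsto (fun η : ℝ => Real.exp (2 * η) * ((1 + η) / (1 - η))) (𝓝[>] 0) (𝓝 1) := by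
    have : ContinuousAt (fun η : ℝ => Real.exp (2 * η) * ((1 + η) / (1 - η))) 0 := by
      refine ContinuousAt.mul (by fun_prop) (ContinuousAt.div (by fun_prop) (by fun_prop) (by simp))
    simpa [ContinuousAt] using this.tendsto.mono_left (nhdsWithin_le_nhds (s := Ioi 0))
  have hd : Tendsto (fun η : ℝ => Real.exp (-(2 * η)) * (1 - η - (Real.log 4 + 4) * η))
      (𝓝[>] 0) (𝓝 1) := by
    have : ContinuousAt (fun η : ℝ => Real.exp (-(2 * η)) * (1 - η - (Real.log 4 + 4) * η)) 0 := by
      fun_prop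
    simpa [ContinuousAt] using this.tendsto.mono_left (nhdsWithin_le_nhds (s := Ioi 0))
  have h1 : ∀ᶠ η : ℝ in 𝓝[>] 0, 0 < η ∧ η < 1 := by
    filter_upwards [Ioo_mem_nhdsGT (show (0:ℝ) < 1 by norm_num)] with η h using h
  rw [tendsto_order]
  constructor
  · intro a ha
    obtain ⟨η, h, h2⟩ := ((hd.eventually (lt_mem_nhds ha)).and h1).exists
    filter_upwards [eventually_psiExp_bounds h2.1 h2.2] with v hv using h.trans_le hv.2
  · intro a ha
    obtain ⟨η, h, h2⟩ := ((hu.eventually (gt_mem_nhds ha)).and h1).exists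
    filter_upwards [eventually_psiExp_bounds h2.1 h2.2] with v hv using hv.1.trans_lt h

/-- The prime number theorem, for the Chebyshev function `θ`. -/
theorem tendsto_theta_div_id : Tendsto (fun x : ℝ => θ x / x) atTop (𝓝 1) := by
  have h1 : Tendsto (fun x : ℝ => ψ x / x) atTop (𝓝 1) := by
    refine (tendsto_psiExp.comp Real.tendsto_log_atTop).congr' ?_
    filter_upwards [eventually_gt_atTop 0] with x hx
    simp only [Function.comp, psiExp, Real.exp_neg, Real.exp_log hx, div_eq_mul_inv]
  have h2 : Tendsto (fun x : ℝ => (ψ x - θ x) / x) atTop (𝓝 0) := by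
    have h3 : (fun x : ℝ => √x) =o[atTop] fun x : ℝ => x := by
      rw [Asymptotics.isLittleO_iff_tendsto' (by
        filter_upwards [eventually_gt_atTop 0] with x hx h0 using absurd h0 hx.ne')]
      simp only [Real.sqrt_div_self]
      exact tendsto_inv_atTop_zero.comp Real.tendsto_sqrt_atTop
    exact (isBigO_psi_sub_theta_sqrt.trans_isLittleO h3).tendsto_div_nhds_zero
  have := h1.sub h2
  rw [sub_zero] at this
  refine this.congr fun x => ?_
  ring

end PrimeNumberTheorem

section FirstMoment
open Topology Set Chebyshev

/-- The set of slopes `α` for which `⌊α p + β⌋` is prime. -/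
def primeSlopes (β : ℝ) (p : ℕ) : Set ℝ := {α | Nat.Prime (⌊α * p + β⌋).toNat}

lemma measurableSet_primeSlopes (β : ℝ) (p : ℕ) : MeasurableSet (primeSlopes β p) := by
  have h : Measurable fun α : ℝ => ⌊α * p + β⌋ :=
    Int.measurable_floor.comp ((measurable_id.mul_const _).add_const _)
  exact h (MeasurableSet.of_discrete (s := {k : ℤ | Nat.Prime k.toNat}))

lemma piStar_natCast (α β : ℝ) (N : ℕ) :
    (piStar α β N : ℝ) =
      ∑ p ∈ Finset.Ioc 0 N with p.Prime, (primeSlopes β p).indicator (1 : ℝ → ℝ) α := by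
  classical
  have h : {p : ℕ | p.Prime ∧ (p : ℝ) ≤ N ∧ Nat.Prime (⌊α * p + β⌋).toNat} =
      (((Finset.Ioc 0 N).filter Nat.Prime).filter fun p => α ∈ primeSlopes β p : Finset ℕ) := by
    ext p
    rw [Finset.mem_coe, Finset.mem_filter, Finset.mem_filter, Finset.mem_Ioc]
    simp only [mem_ofPred_eq, Nat.cast_le, primeSlopes]
    constructor
    · rintro ⟨h1, h2, h3⟩
      exact ⟨⟨⟨h1.pos, h2⟩, h1⟩, h3⟩
    · rintro ⟨⟨⟨_, h2⟩, h1⟩, h3⟩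
      exact ⟨h1, h2, h3⟩
  rw [piStar, h, ncard_coe_finset, Finset.card_filter]
  push_cast
  refine Finset.sum_congr rfl fun p _ => ?_
  simp [indicator]

lemma card_primes_div_le_volume {a b β : ℝ} {p : ℕ} (hp : 0 < p) (hb : 0 ≤ b * p + β - 1)
    (ha : 0 ≤ a * p + β) :
    (((Finset.Ioc ⌊a * p + β⌋₊ ⌊b * p + β - 1⌋₊).filter Nat.Prime).card : ℝ) / p ≤
      volume.real (primeSlopes β p ∩ Icc a b) := by
  have hp' : (0 : ℝ) < p := by exact_mod_cast hp
  set Q := (Finset.Ioc ⌊a * p + β⌋₊ ⌊b * p + β - 1⌋₊).filter Nat.Prime with hQ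
  let J : ℕ → Set ℝ := fun q => Ico ((q - β) / p) ((q + 1 - β) / p)
  have hJ : ∀ q : ℕ, ∀ α ∈ J q, ⌊α * p + β⌋ = q := by
    intro q α hα
    have h1 := (div_le_iff₀ hp').1 hα.1
    have h2 := (lt_div_iff₀ hp').1 hα.2
    rw [Int.floor_eq_iff]
    push_cast
    constructor <;> linarith
  have hdis : (Q : Set ℕ).PairwiseDisjoint J := by
    intro q _ r _ hqr
    refine Set.disjoint_left.2 fun α h1 h2 => hqr ?_
    have := (hJ q α h1).symm.trans (hJ r α h2)
    exact_mod_cast this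
  have hsub : (⋃ q ∈ Q, J q) ⊆ primeSlopes β p ∩ Icc a b := by
    intro α hα
    simp only [mem_iUnion] at hα
    obtain ⟨q, hq, hα⟩ := hα
    rw [hQ, Finset.mem_filter, Finset.mem_Ioc] at hq
    refine ⟨?_, ?_, ?_⟩
    · simp only [primeSlopes, mem_ofPred_eq, hJ q α hα, Int.toNat_natCast]
      exact hq.2
    · have h1 := (Nat.floor_lt ha).1 hq.1.1
      have h2 := (div_le_iff₀ hp').1 hα.1
      nlinarith
    · have h1 := (Nat.le_floor_iff hb).1 hq.1.2
      have h2 := (lt_div_iff₀ hp').1 hα.2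
      nlinarith
  have hfin : volume (primeSlopes β p ∩ Icc a b) ≠ ⊤ :=
    ((measure_mono inter_subset_right).trans_lt (by simp)).ne
  refine le_trans (le_of_eq ?_) (measureReal_mono hsub hfin)
  rw [measureReal_biUnion_finset hdis (fun q _ => measurableSet_Ico)
    (fun q _ => by simp [J])]
  have : ∀ q ∈ Q, volume.real (J q) = 1 / p := by
    intro q _
    rw [Real.volume_real_Ico_of_le (by gcongr; linarith)]
    ring
  rw [Finset.sum_congr rfl this, Finset.sum_const, nsmul_eq_mul]
  ring

lemma theta_sub_theta_le {x y : ℝ} (hy : 1 ≤ y) :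
    θ y - θ x ≤ ((Finset.Ioc ⌊x⌋₊ ⌊y⌋₊).filter Nat.Prime).card * Real.log y := by
  have h : θ y ≤ θ x + ∑ q ∈ (Finset.Ioc ⌊x⌋₊ ⌊y⌋₊).filter Nat.Prime, Real.log q := by
    rw [theta, theta, ← Finset.sum_union]
    · refine Finset.sum_le_sum_of_subset_of_nonneg ?_ ?_
      · intro q hq
        simp only [Finset.mem_union, Finset.mem_filter, Finset.mem_Ioc] at hq ⊢
        by_cases h : q ≤ ⌊x⌋₊
        · exact Or.inl ⟨⟨hq.1.1, h⟩, hq.2⟩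
        · exact Or.inr ⟨⟨not_le.1 h, hq.1.2⟩, hq.2⟩
      · intro q _ _
        exact Real.log_natCast_nonneg q
    · refine Finset.disjoint_left.2 fun q h1 h2 => ?_
      simp only [Finset.mem_filter, Finset.mem_Ioc] at h1 h2
      omega
  have h2 : ∑ q ∈ (Finset.Ioc ⌊x⌋₊ ⌊y⌋₊).filter Nat.Prime, Real.log q ≤
      ((Finset.Ioc ⌊x⌋₊ ⌊y⌋₊).filter Nat.Prime).card * Real.log y := by
    rw [← nsmul_eq_mul]
    refine Finset.sum_le_card_nsmul _ _ _ fun q hq => ?_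
    simp only [Finset.mem_filter, Finset.mem_Ioc] at hq
    refine Real.log_le_log (by exact_mod_cast hq.2.pos) ?_
    exact (Nat.le_floor_iff (by linarith)).1 hq.1.2
  linarith

lemma tendsto_theta_affine_div {a : ℝ} (ha : 0 < a) (β : ℝ) :
    Tendsto (fun x : ℝ => θ (a * x + β) / x) atTop (𝓝 a) := by
  have h1 : Tendsto (fun x : ℝ => a * x + β) atTop atTop :=
    tendsto_atTop_add_const_right _ _ (tendsto_id.const_mul_atTop ha)
  have h2 : Tendsto (fun x : ℝ => a + β * x⁻¹) atTop (𝓝 a) := by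
    simpa using tendsto_const_nhds.add (tendsto_inv_atTop_zero.const_mul β)
  have h3 := (tendsto_theta_div_id.comp h1).mul h2
  rw [one_mul] at h3
  refine h3.congr' ?_
  filter_upwards [eventually_gt_atTop 0, h1.eventually_gt_atTop 0] with x hx hx2
  simp only [Function.comp]
  field_simp

lemma eventually_le_volume_primeSlopes {a b c : ℝ} (ha : 0 < a) (hab : a < b) (β : ℝ)
    (hc : c < b - a) :
    ∀ᶠ p : ℕ in atTop, c ≤ volume.real (primeSlopes β p ∩ Icc a b) *
      Real.log (b * p + β - 1) ∧ 1 < b * p + β - 1 := by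
  have hb := ha.trans hab
  have h1 := (tendsto_theta_affine_div hb (β - 1)).sub (tendsto_theta_affine_div ha β)
  have h2 : Tendsto (fun x : ℝ => a * x + β) atTop atTop :=
    tendsto_atTop_add_const_right _ _ (tendsto_id.const_mul_atTop ha)
  have h3 : Tendsto (fun x : ℝ => b * x + (β - 1)) atTop atTop :=
    tendsto_atTop_add_const_right _ _ (tendsto_id.const_mul_atTop hb)
  filter_upwards [tendsto_natCast_atTop_atTop.eventually (h1.eventually (lt_mem_nhds hc)),
    tendsto_natCast_atTop_atTop.eventually (h2.eventually_gt_atTop 0),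
    tendsto_natCast_atTop_atTop.eventually (h3.eventually_gt_atTop 1),
    eventually_gt_atTop 0] with p e1 e2 e3 e4
  rw [← add_sub_assoc] at e1 e3
  refine ⟨?_, e3⟩
  have hp' : (0 : ℝ) < p := by exact_mod_cast e4
  refine e1.le.trans ?_
  rw [← sub_div]
  have h4 := card_primes_div_le_volume e4 (by linarith : 0 ≤ b * p + β - 1) e2.le
  have h5 := theta_sub_theta_le (x := a * p + β) e3.le
  have h6 := mul_le_mul_of_nonneg_right h4 (Real.log_pos e3).le
  refine le_trans ?_ h6
  rw [div_mul_eq_mul_div]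
  gcongr

lemma integral_piStar (a b β : ℝ) (N : ℕ) (s : Set ℝ)
    (hsab : s ⊆ Icc a b) :
    ∫ α in s, (piStar α β N : ℝ) =
      ∑ p ∈ Finset.Ioc 0 N with p.Prime, volume.real (primeSlopes β p ∩ s) := by
  simp_rw [piStar_natCast]
  have hfin : volume s ≠ ⊤ := ((measure_mono hsab).trans_lt (by simp)).ne
  rw [integral_finsetSum]
  · refine Finset.sum_congr rfl fun p _ => ?_
    rw [integral_indicator_one (measurableSet_primeSlopes β p), measureReal_restrict_apply
      (measurableSet_primeSlopes β p)]
  · intro p _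
    have : IntegrableOn (1 : ℝ → ℝ) s := by
      exact integrableOn_const (C := (1 : ℝ)) hfin
    exact this.indicator (measurableSet_primeSlopes β p)

/-- Lower bound for the mean of `π*` over an interval of slopes. -/
lemma eventually_le_integral_piStar {a b c : ℝ} (ha : 0 < a) (hab : a < b) (β : ℝ)
    (hc : c < b - a) :
    ∀ᶠ N : ℕ in atTop, c * N / Real.log N ^ 2 ≤ ∫ α in Icc a b, (piStar α β N : ℝ) := by
  have hb := ha.trans hab
  obtain ⟨d, hd, hdb⟩ := exists_between (max_lt hc (sub_pos.2 hab))
  have hcd : c < d := (le_max_left _ _).trans_lt hd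
  have hd0 : 0 < d := (le_max_right _ _).trans_lt hd
  obtain ⟨p₀, hp₀⟩ := eventually_atTop.1 (eventually_le_volume_primeSlopes ha hab β hdb)
  set C := b + |β| with hC
  have hC0 : 0 < C := by positivity
  have hlim : Tendsto (fun x : ℝ => (θ x / x - p₀ * (Real.log x / x)) *
      (d * (1 / (Real.log C / Real.log x + 1)))) atTop (𝓝 ((1 - p₀ * 0) * (d * (1 / (0 + 1))))) := by
    refine (tendsto_theta_div_id.sub (Tendsto.const_mul _ ?_)).mul (Tendsto.const_mul _ ?_)
    · simpa using Real.isLittleO_log_id_atTop.tendsto_div_nhds_zero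
    · refine tendsto_const_nhds.div ?_ (by norm_num)
      exact (tendsto_const_nhds.div_atTop Real.tendsto_log_atTop).add_const _
  have hlt : c < (1 - p₀ * 0) * (d * (1 / (0 + 1))) := by simpa using hcd
  filter_upwards [tendsto_natCast_atTop_atTop.eventually (hlim.eventually (lt_mem_nhds hlt)),
    tendsto_natCast_atTop_atTop.eventually (Real.tendsto_log_atTop.eventually_gt_atTop 0),
    tendsto_natCast_atTop_atTop.eventually
      ((Real.tendsto_log_atTop.comp (tendsto_id.const_mul_atTop hC0)).eventually_gt_atTop 0),
    eventually_gt_atTop 1] with N h1 h2 h3 h4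
  simp only [Function.comp, id] at h3
  have hN : (1 : ℝ) < N := by exact_mod_cast h4
  have hlogC : Real.log (C * N) = Real.log C + Real.log N :=
    Real.log_mul hC0.ne' (by positivity)
  have key : (N.primeCounting - p₀ : ℝ) * (d / Real.log (C * N)) ≤
      ∫ α in Icc a b, (piStar α β N : ℝ) := by
    rw [integral_piStar a b β N _ subset_rfl]
    have hsub : ((Finset.Ioc 0 N).filter Nat.Prime).filter (fun p => p₀ ≤ p) ⊆
      (Finset.Ioc 0 N).filter Nat.Prime := Finset.filter_subset _ _
    refine le_trans ?_ (Finset.sum_le_sum_of_subset_of_nonneg hsub fun _ _ _ => measureReal_nonneg)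
    have hcard : (N.primeCounting - p₀ : ℝ) ≤
        (((Finset.Ioc 0 N).filter Nat.Prime).filter (fun p => p₀ ≤ p)).card := by
      have e1 : N.primeCounting = ((Finset.Ioc 0 N).filter Nat.Prime).card := by
        rw [Nat.primeCounting, Nat.primeCounting', Nat.count_eq_card_filter_range]
        congr 1
        ext q
        simp only [Finset.mem_filter, Finset.mem_range, Finset.mem_Ioc]
        exact ⟨fun h => ⟨⟨h.2.pos, by omega⟩, h.2⟩, fun h => ⟨by omega, h.2⟩⟩
      have e2 := Finset.card_filter_add_card_filter_not (s := (Finset.Ioc 0 N).filter Nat.Prime)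
        (fun p => p₀ ≤ p)
      have e3 : (((Finset.Ioc 0 N).filter Nat.Prime).filter (fun p => ¬ p₀ ≤ p)).card ≤ p₀ := by
        refine (Finset.card_le_card (t := Finset.range p₀) ?_).trans (by simp)
        intro q hq
        simp only [Finset.mem_filter] at hq
        simpa using hq.2
      have : N.primeCounting ≤
          (((Finset.Ioc 0 N).filter Nat.Prime).filter (fun p => p₀ ≤ p)).card + p₀ := by omega
      rw [sub_le_iff_le_add]
      exact_mod_cast this
    have hdd : 0 ≤ d / Real.log (C * N) := by positivity
    refine (mul_le_mul_of_nonneg_right hcard hdd).trans ?_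
    rw [← nsmul_eq_mul]
    refine Finset.card_nsmul_le_sum _ _ _ fun p hp => ?_
    simp only [Finset.mem_filter, Finset.mem_Ioc] at hp
    obtain ⟨e1, e2⟩ := hp₀ p hp.2
    rw [div_le_iff₀ h3]
    refine e1.trans (mul_le_mul_of_nonneg_left ?_ measureReal_nonneg)
    refine Real.log_le_log (by linarith) ?_
    have hpN : (p : ℝ) ≤ N := by exact_mod_cast hp.1.1.2
    have : b * p ≤ b * N := by gcongr
    have : |β| * 1 ≤ |β| * N := by gcongr
    rw [hC]
    linarith [le_abs_self β]
  refine le_trans ?_ key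
  have hth := theta_le_pi_mul_log N
  have h5 : θ N / Real.log N ≤ N.primeCounting := by rwa [div_le_iff₀ h2]
  have h6 : (θ N / Real.log N - p₀) * (d / Real.log (C * N)) ≤
      (N.primeCounting - p₀ : ℝ) * (d / Real.log (C * N)) := by
    have hdd : 0 ≤ d / Real.log (C * N) := by positivity
    gcongr
  refine le_trans ?_ h6
  have h7 : (θ N / Real.log N - p₀) * (d / Real.log (C * N)) =
      ((θ N / N - p₀ * (Real.log N / N)) * (d * (1 / (Real.log C / Real.log N + 1)))) *
        (N / Real.log N ^ 2) := by
    have : Real.log C / Real.log N + 1 = Real.log (C * N) / Real.log N := by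
      rw [hlogC]; field_simp
    rw [this]
    field_simp
  rw [h7, mul_div_assoc]
  exact mul_le_mul_of_nonneg_right h1.le (by positivity)

end FirstMoment

section SelbergWeights
open ArithmeticFunction ArithmeticFunction.Moebius Finset

/-- The sum `∑_{k ≤ z} μ(k)² / φ(k)`. -/
noncomputable def selbergMass (z : ℕ) : ℝ := ∑ k ∈ Icc 1 z, (μ k : ℝ) ^ 2 / k.totient

/-- The optimal Selberg upper bound sieve weights of level `z`. -/
noncomputable def selbergWeight (z d : ℕ) : ℝ :=
  μ d * d / selbergMass z * ∑ k ∈ Icc 1 z with d ∣ k, (μ k : ℝ) ^ 2 / k.totient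

lemma selbergMass_pos {z : ℕ} (hz : 1 ≤ z) : 0 < selbergMass z := by
  refine lt_of_lt_of_le zero_lt_one ?_
  have := Finset.single_le_sum (f := fun k : ℕ => (μ k : ℝ) ^ 2 / k.totient)
    (fun k _ => by positivity) (mem_Icc.2 ⟨le_rfl, hz⟩)
  simpa [selbergMass] using this

lemma selbergWeight_one {z : ℕ} (hz : 1 ≤ z) : selbergWeight z 1 = 1 := by
  have h : (Icc 1 z).filter (1 ∣ ·) = Icc 1 z := by simp
  rw [selbergWeight, h, ← selbergMass]
  simp [(selbergMass_pos hz).ne']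

lemma abs_selbergWeight_le {z : ℕ} (hz : 1 ≤ z) (d : ℕ) : |selbergWeight z d| ≤ d := by
  have hL := selbergMass_pos hz
  have h0 : 0 ≤ ∑ k ∈ Icc 1 z with d ∣ k, (μ k : ℝ) ^ 2 / k.totient :=
    sum_nonneg fun k _ => by positivity
  have h1 : ∑ k ∈ Icc 1 z with d ∣ k, (μ k : ℝ) ^ 2 / k.totient ≤ selbergMass z :=
    sum_le_sum_of_subset_of_nonneg (filter_subset _ _) fun k _ _ => by positivity
  have h2 : |(μ d : ℝ)| ≤ 1 := by exact_mod_cast abs_moebius_le_one (n := d)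
  rw [selbergWeight, abs_mul, abs_div, abs_mul, abs_of_pos hL, abs_of_nonneg h0,
    Nat.abs_cast, div_mul_eq_mul_div, div_le_iff₀ hL]
  have h3 : |(μ d : ℝ)| * d ≤ 1 * d := by gcongr
  calc _ ≤ (1 * (d : ℝ)) * selbergMass z := mul_le_mul h3 h1 h0 (by positivity)
    _ = _ := by ring

lemma sum_moebius_filter_dvd {k m : ℕ} (hm : Squarefree m) :
    ∑ d ∈ m.divisors with k ∣ d, (μ d : ℝ) = if k = m then (μ k : ℝ) else 0 := by
  by_cases hkm : k ∣ m
  · obtain ⟨e, rfl⟩ := hkm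
    have hke := (Nat.squarefree_mul_iff.1 hm)
    have hk0 : k ≠ 0 := hke.2.1.ne_zero
    have he0 : e ≠ 0 := hke.2.2.ne_zero
    have h : ((k * e).divisors.filter (k ∣ ·)) = e.divisors.map ⟨(k * ·), mul_right_injective₀ hk0⟩ := by
      ext d
      simp only [mem_filter, Nat.mem_divisors, Finset.mem_map, Function.Embedding.coeFn_mk]
      constructor
      · rintro ⟨⟨h1, _⟩, ⟨c, rfl⟩⟩
        exact ⟨c, ⟨Nat.dvd_of_mul_dvd_mul_left (Nat.pos_of_ne_zero hk0) h1, he0⟩, rfl⟩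
      · rintro ⟨c, ⟨h1, _⟩, rfl⟩
        exact ⟨⟨Nat.mul_dvd_mul_left k h1, mul_ne_zero hk0 he0⟩, dvd_mul_right _ _⟩
    rw [h, sum_map]
    have h2 : ∀ c ∈ e.divisors, (μ (k * c) : ℝ) = μ k * μ c := by
      intro c hc
      have hc' : k.Coprime c := hke.1.coprime_dvd_right (Nat.dvd_of_mem_divisors hc)
      rw [isMultiplicative_moebius.map_mul_of_coprime hc']
      push_cast; rfl
    simp only [Function.Embedding.coeFn_mk]
    rw [sum_congr rfl h2, ← mul_sum]
    have h3 : ∑ c ∈ e.divisors, μ c = if e = 1 then 1 else 0 := by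
      rw [← coe_mul_zeta_apply, moebius_mul_coe_zeta, one_apply]
    have h4 : ∑ c ∈ e.divisors, (μ c : ℝ) = if e = 1 then 1 else 0 := by exact_mod_cast h3
    rw [h4]
    have h5 : k = k * e ↔ e = 1 := by
      constructor
      · intro h
        exact (Nat.eq_of_mul_eq_mul_left (Nat.pos_of_ne_zero hk0) (by linarith : k * e = k * 1))
      · rintro rfl; simp
    simp only [h5, mul_ite, mul_one, mul_zero]
  · rw [if_neg (by rintro rfl; exact hkm dvd_rfl)]
    refine sum_eq_zero fun d hd => ?_
    simp only [mem_filter, Nat.mem_divisors] at hd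
    exact absurd (hd.2.trans hd.1.1) hkm

lemma sum_selbergWeight_div {z k : ℕ} (hk : k ∈ Icc 1 z) :
    ∑ d ∈ Icc 1 z with k ∣ d, selbergWeight z d / d =
      μ k / (k.totient * selbergMass z) := by
  have hz : 1 ≤ z := by rw [mem_Icc] at hk; omega
  have hL := selbergMass_pos hz
  have h1 : ∀ d ∈ (Icc 1 z).filter (k ∣ ·), selbergWeight z d / d =
      ∑ m ∈ Icc 1 z, if d ∣ m then μ d / selbergMass z * ((μ m : ℝ) ^ 2 / m.totient) else 0 := by
    intro d hd
    have hd0 : (d : ℝ) ≠ 0 := by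
      simp only [mem_filter, mem_Icc] at hd
      exact_mod_cast (by omega : d ≠ 0)
    rw [selbergWeight, ← sum_filter, ← mul_sum]
    field_simp
  rw [sum_congr rfl h1, sum_comm]
  have h2 : ∀ m ∈ Icc 1 z, (∑ d ∈ Icc 1 z with k ∣ d,
      if d ∣ m then μ d / selbergMass z * ((μ m : ℝ) ^ 2 / m.totient) else 0) =
      if k = m then μ k / (k.totient * selbergMass z) else 0 := by
    intro m hm
    rw [mem_Icc] at hm
    rw [← sum_filter, filter_filter]
    have h3 : ((Icc 1 z).filter fun d => k ∣ d ∧ d ∣ m) = m.divisors.filter (k ∣ ·) := by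
      ext d
      simp only [mem_filter, mem_Icc, Nat.mem_divisors]
      constructor
      · rintro ⟨_, h, h'⟩
        exact ⟨⟨h', by omega⟩, h⟩
      · rintro ⟨⟨h', _⟩, h⟩
        exact ⟨⟨Nat.pos_of_dvd_of_pos h' (by omega), (Nat.le_of_dvd (by omega) h').trans hm.2⟩, h, h'⟩
    rw [h3, ← sum_mul, ← sum_div]
    by_cases hsq : Squarefree m
    · rw [sum_moebius_filter_dvd hsq]
      split_ifs with hkm
      · subst hkm
        have : (μ k : ℝ) ^ 2 = 1 := by exact_mod_cast moebius_sq_eq_one_of_squarefree hsq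
        rw [this]
        field_simp
      · simp
    · have h4 : (μ m : ℝ) = 0 := by exact_mod_cast moebius_eq_zero_of_not_squarefree hsq
      rw [h4]
      split_ifs with hkm
      · rw [hkm, h4]; simp
      · simp
  rw [sum_congr rfl h2, sum_ite_eq, if_pos hk]

/-- The Selberg weights diagonalise the quadratic form with matrix `1 / lcm(d, e)`. -/
lemma sum_selbergWeight_div_lcm {z : ℕ} (hz : 1 ≤ z) :
    ∑ d ∈ Icc 1 z, ∑ e ∈ Icc 1 z, selbergWeight z d * selbergWeight z e / (d.lcm e : ℕ) =
      1 / selbergMass z := by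
  have hL := selbergMass_pos hz
  have h1 : ∀ d ∈ Icc 1 z, ∀ e ∈ Icc 1 z,
      selbergWeight z d * selbergWeight z e / (d.lcm e : ℕ) =
      ∑ k ∈ Icc 1 z, (k.totient : ℝ) * ((if k ∣ d then selbergWeight z d / d else 0) *
        if k ∣ e then selbergWeight z e / e else 0) := by
    intro d hd e he
    rw [mem_Icc] at hd he
    have hd0 : (d : ℝ) ≠ 0 := by exact_mod_cast (by omega : d ≠ 0)
    have he0 : (e : ℝ) ≠ 0 := by exact_mod_cast (by omega : e ≠ 0)
    have hg0 : d.gcd e ≠ 0 := Nat.gcd_ne_zero_left (by omega)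
    have h2 : ((d.gcd e : ℕ) : ℝ) = ∑ k ∈ Icc 1 z with k ∣ d ∧ k ∣ e, (k.totient : ℝ) := by
      rw [← Nat.sum_totient (d.gcd e)]
      push_cast
      refine sum_congr ?_ fun _ _ => rfl
      ext k
      simp only [Nat.mem_divisors, mem_filter, mem_Icc, Nat.dvd_gcd_iff]
      constructor
      · rintro ⟨h, _⟩
        exact ⟨⟨Nat.pos_of_dvd_of_pos h.1 (by omega), (Nat.le_of_dvd (by omega) h.1).trans hd.2⟩, h⟩
      · rintro ⟨_, h⟩
        exact ⟨h, hg0⟩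
    have h3 : ((d.gcd e : ℕ) : ℝ) * (d.lcm e : ℕ) = d * e := by
      exact_mod_cast Nat.gcd_mul_lcm d e
    have hl0 : ((d.lcm e : ℕ) : ℝ) ≠ 0 := by
      exact_mod_cast Nat.lcm_ne_zero (by omega) (by omega)
    have h4 : selbergWeight z d * selbergWeight z e / (d.lcm e : ℕ) =
        ((d.gcd e : ℕ) : ℝ) * (selbergWeight z d / d * (selbergWeight z e / e)) := by
      field_simp
      linear_combination -(selbergWeight z d * selbergWeight z e) * h3
    rw [h4, h2, sum_mul, sum_filter]
    refine sum_congr rfl fun k _ => ?_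
    by_cases hk1 : k ∣ d <;> by_cases hk2 : k ∣ e <;> simp [hk1, hk2]
  rw [sum_congr rfl fun d hd => sum_congr rfl fun e he => h1 d hd e he]
  have h5 : ∀ d ∈ Icc 1 z, (∑ e ∈ Icc 1 z, ∑ k ∈ Icc 1 z, (k.totient : ℝ) *
      ((if k ∣ d then selbergWeight z d / d else 0) *
        if k ∣ e then selbergWeight z e / e else 0)) =
      ∑ k ∈ Icc 1 z, (k.totient : ℝ) * ((if k ∣ d then selbergWeight z d / d else 0) *
        ∑ e ∈ Icc 1 z, if k ∣ e then selbergWeight z e / e else 0) := by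
    intro d _
    rw [sum_comm]
    simp_rw [← mul_sum]
  rw [sum_congr rfl h5, sum_comm]
  simp_rw [← mul_sum, ← sum_mul, ← sum_filter]
  have h6 : ∀ k ∈ Icc 1 z, (k.totient : ℝ) *
      ((∑ d ∈ Icc 1 z with k ∣ d, selbergWeight z d / d) *
        ∑ d ∈ Icc 1 z with k ∣ d, selbergWeight z d / d) =
      ((μ k : ℝ) ^ 2 / k.totient) * (1 / selbergMass z ^ 2) := by
    intro k hk
    rw [sum_selbergWeight_div hk]
    have : (k.totient : ℝ) ≠ 0 := by
      rw [mem_Icc] at hk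
      exact_mod_cast (Nat.totient_pos.2 (by omega)).ne'
    field_simp
  rw [sum_congr rfl h6, ← sum_mul, ← selbergMass]
  field_simp

lemma log_le_selbergMass {z : ℕ} (hz : 1 ≤ z) : Real.log z / 2 ≤ selbergMass z := by
  have h1 : ∑ k ∈ Icc 1 z, (μ k : ℝ) ^ 2 / k ≤ selbergMass z := by
    refine sum_le_sum fun k hk => ?_
    rw [mem_Icc] at hk
    have h0 : (0 : ℝ) < k.totient := by exact_mod_cast Nat.totient_pos.2 (by omega)
    have : (k.totient : ℝ) ≤ k := by exact_mod_cast Nat.totient_le k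
    gcongr
  have h2 : ∑ b ∈ Icc 1 z, ((b : ℝ) ^ 2)⁻¹ ≤ 2 := by
    have := sum_Ioc_inv_sq_le_sub (α := ℝ) one_ne_zero hz
    have h3 : Icc 1 z = insert 1 (Ioc 1 z) := by
      ext b; simp only [mem_Icc, mem_insert, mem_Ioc]; omega
    rw [h3, sum_insert (by simp)]
    have h4 : (0:ℝ) ≤ (z : ℝ)⁻¹ := by positivity
    norm_num at this ⊢
    linarith
  have h3 : ∑ n ∈ Icc 1 z, ((n : ℝ))⁻¹ ≤
      (∑ k ∈ Icc 1 z, (μ k : ℝ) ^ 2 / k) * ∑ b ∈ Icc 1 z, ((b : ℝ) ^ 2)⁻¹ := by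
    rw [sum_mul_sum, ← sum_product']
    choose a b hab hsq using Nat.sq_mul_squarefree
    have hinj : Set.InjOn (fun n => (a n, b n)) (Icc 1 z : Finset ℕ) := by
      intro n _ m _ h
      simp only [Prod.mk.injEq] at h
      rw [← hab n, ← hab m, h.1, h.2]
    have hsub : (Icc 1 z).image (fun n => (a n, b n)) ⊆ Icc 1 z ×ˢ Icc 1 z := by
      intro x hx
      obtain ⟨n, hn, rfl⟩ := mem_image.1 hx
      rw [mem_Icc] at hn
      have ha0 : a n ≠ 0 := (hsq n).ne_zero
      have hb0 : b n ≠ 0 := by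
        intro h; have := hab n; rw [h] at this; simp at this; omega
      have h4 : a n ≤ n := by
        conv_rhs => rw [← hab n]
        exact Nat.le_mul_of_pos_left _ (by positivity)
      have h5 : b n ≤ n := by
        conv_rhs => rw [← hab n]
        exact (Nat.le_self_pow two_ne_zero _).trans (Nat.le_mul_of_pos_right _ (by positivity))
      simp only [mem_product, mem_Icc]
      omega
    refine le_trans ?_ (sum_le_sum_of_subset_of_nonneg hsub fun _ _ _ => by positivity)
    rw [sum_image hinj]
    refine sum_le_sum fun n hn => ?_
    have : (μ (a n) : ℝ) ^ 2 = 1 := by exact_mod_cast moebius_sq_eq_one_of_squarefree (hsq n)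
    rw [this]
    conv_lhs => rw [← hab n]
    push_cast
    rw [mul_inv, one_div, mul_comm]
  have h4 : Real.log z ≤ ∑ n ∈ Icc 1 z, ((n : ℝ))⁻¹ := by
    have h5 := log_add_one_le_harmonic z
    rw [harmonic_eq_sum_Icc] at h5
    push_cast at h5
    refine le_trans (Real.log_le_log (by exact_mod_cast hz) ?_) h5
    linarith
  have h6 : 0 ≤ ∑ k ∈ Icc 1 z, (μ k : ℝ) ^ 2 / k := sum_nonneg fun _ _ => by positivity
  have h7 := mul_le_mul_of_nonneg_left h2 h6
  linarith

end SelbergWeights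

section Discrepancy
open Set

lemma Icc_filter_dvd_eq_image {D : ℕ} (hD : 0 < D) (N : ℕ) :
    (Finset.Icc 1 N).filter (D ∣ ·) = (Finset.Icc 1 (N / D)).image (D * ·) := by
  ext m
  simp only [Finset.mem_filter, Finset.mem_Icc, Finset.mem_image]
  constructor
  · rintro ⟨h, k, rfl⟩
    exact ⟨k, ⟨Nat.pos_of_ne_zero (by rintro rfl; omega),
      (Nat.le_div_iff_mul_le hD).2 (by linarith [h.2, mul_comm D k])⟩, rfl⟩
  · rintro ⟨k, ⟨h1, h2⟩, rfl⟩
    have := (Nat.le_div_iff_mul_le hD).1 h2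
    exact ⟨⟨Nat.mul_pos hD h1, by linarith [mul_comm D k]⟩, dvd_mul_right _ _⟩

lemma sum_fract_add_div {b : ℕ} (hb : 0 < b) (y : ℝ) :
    ∑ i ∈ Finset.range b, Int.fract (y + i / b) =
      Int.fract (b * y) + ∑ i ∈ Finset.range b, (i : ℝ) / b := by
  have hb' : (0 : ℝ) < b := by exact_mod_cast hb
  let H : ℝ → ℝ := fun y => ∑ i ∈ Finset.range b, Int.fract (y + i / b) - Int.fract (b * y)
  have hper : Function.Periodic H (1 / b) := by
    intro y
    have h1 : Int.fract (b * (y + 1 / b)) = Int.fract (b * y) := by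
      rw [← Int.fract_add_one (b * y)]
      congr 1
      field_simp
    have h2 : ∀ i : ℕ, y + 1 / b + (i : ℝ) / b = y + ((i + 1 : ℕ) : ℝ) / b := by
      intro i; push_cast; ring
    have h3 := Finset.sum_range_succ (fun i : ℕ => Int.fract (y + (i : ℝ) / b)) b
    have h4 := Finset.sum_range_succ' (fun i : ℕ => Int.fract (y + (i : ℝ) / b)) b
    have h5 : Int.fract (y + (b : ℝ) / b) = Int.fract (y + ((0 : ℕ) : ℝ) / b) := by
      rw [div_self hb'.ne', Int.fract_add_one]; simp
    simp only [H, h1, h2]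
    linarith
  have h0 : ∀ y ∈ Ico (0 : ℝ) (1 / b), H y = ∑ i ∈ Finset.range b, (i : ℝ) / b := by
    intro y hy
    have hby : b * y < 1 := by
      have := (lt_div_iff₀ hb').1 hy.2; linarith
    have h1 : Int.fract (b * y) = b * y :=
      Int.fract_eq_self.2 ⟨mul_nonneg hb'.le hy.1, hby⟩
    have h2 : ∀ i ∈ Finset.range b, Int.fract (y + (i : ℝ) / b) = y + (i : ℝ) / b := by
      intro i hi
      have hi' : (i : ℝ) + 1 ≤ b := by exact_mod_cast Finset.mem_range.1 hi
      refine Int.fract_eq_self.2 ⟨by have := hy.1; positivity, ?_⟩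
      calc y + (i : ℝ) / b < 1 / b + i / b := by have := hy.2; gcongr
        _ = (i + 1) / b := by ring
        _ ≤ 1 := by rwa [div_le_one hb']
    simp only [H]
    rw [Finset.sum_congr rfl h2, h1, Finset.sum_add_distrib]
    simp
  have h1 := hper.sub_int_mul_eq (x := y) ⌊b * y⌋
  have h2 := h0 (y - ⌊b * y⌋ * (1 / b)) (by
    have e1 := Int.floor_le (b * y)
    have e2 := Int.lt_floor_add_one (b * y)
    have e3 : y - ⌊b * y⌋ * (1 / b) = (b * y - ⌊b * y⌋) / b := by field_simp
    rw [e3]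
    exact ⟨by apply div_nonneg <;> linarith, by gcongr; linarith⟩)
  rw [h1] at h2
  simp only [H] at h2
  linarith

/-- The indicator of the fractional part of `y` being less than `c`, minus `c`. -/
noncomputable def disc (c y : ℝ) : ℝ := Int.fract (y - c) - Int.fract y

lemma disc_eq_ite {c : ℝ} (hc : 0 < c) (hc1 : c ≤ 1) (y : ℝ) :
    disc c y = (if Int.fract y < c then 1 else 0) - c := by
  have e1 := Int.fract_nonneg y
  have e2 := Int.fract_lt_one y
  have e3 := Int.floor_add_fract y
  split_ifs with h
  · have : ⌊y - c⌋ = ⌊y⌋ - 1 := by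
      rw [Int.floor_eq_iff]; push_cast; constructor <;> linarith
    rw [disc, Int.fract, this]; push_cast; linarith
  · have : ⌊y - c⌋ = ⌊y⌋ := by
      rw [Int.floor_eq_iff]; constructor <;> linarith
    rw [disc, Int.fract, this]; linarith

lemma disc_add_intCast (c y : ℝ) (k : ℤ) : disc c (y + k) = disc c y := by
  rw [disc, disc, Int.fract_add_intCast, add_sub_right_comm, Int.fract_add_intCast]

lemma abs_disc_le (c y : ℝ) : |disc c y| ≤ 1 := by
  rw [abs_le, disc]
  constructor <;> linarith [Int.fract_nonneg y, Int.fract_nonneg (y - c), Int.fract_lt_one y,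
    Int.fract_lt_one (y - c)]

lemma measurable_disc (c : ℝ) : Measurable (disc c) :=
  (measurable_fract.comp (measurable_id.sub_const c)).sub measurable_fract

lemma abs_sum_disc_le {b : ℕ} (hb : 0 < b) (c y : ℝ) :
    |∑ i ∈ Finset.range b, disc c (y + i / b)| ≤ 1 := by
  have h1 := sum_fract_add_div hb y
  have h2 := sum_fract_add_div hb (y - c)
  have h3 : ∑ i ∈ Finset.range b, disc c (y + i / b) =
      Int.fract (b * (y - c)) - Int.fract (b * y) := by
    have : ∀ i : ℕ, disc c (y + i / b) = Int.fract (y - c + i / b) - Int.fract (y + i / b) := by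
      intro i; rw [disc, add_sub_right_comm]
    simp_rw [this, Finset.sum_sub_distrib]
    linarith
  rw [h3, abs_le]
  constructor <;> linarith [Int.fract_nonneg (b * y), Int.fract_nonneg (b * (y - c)),
    Int.fract_lt_one (b * y), Int.fract_lt_one (b * (y - c))]

lemma intervalIntegrable_of_bounded {f : ℝ → ℝ} (hf : Measurable f) {C : ℝ} (hC : ∀ x, |f x| ≤ C)
    (a b : ℝ) : IntervalIntegrable f volume a b := by
  refine (intervalIntegrable_const (c := C)).mono_fun hf.aestronglyMeasurable ?_
  filter_upwards with x
  exact (hC x).trans (le_abs_self C)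

lemma measurable_disc_comp (c m s : ℝ) : Measurable fun θ : ℝ => disc c (m * θ + s) :=
  (measurable_disc c).comp ((measurable_id.const_mul m).add_const s)

lemma abs_integral_disc_mul_disc_le (c s : ℝ) {m m' : ℕ} (hm' : 0 < m') :
    |∫ θ in (0:ℝ)..1, disc c (m * θ + s) * disc c (m' * θ + s)| ≤ (m.gcd m' : ℕ) / m' := by
  obtain ⟨b, hbm⟩ := Nat.gcd_dvd_right m m'
  set g := m.gcd m' with hg
  have hg0 : 0 < g := Nat.gcd_pos_of_pos_right m hm'
  have hb : 0 < b := Nat.pos_of_ne_zero (by rintro rfl; omega)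
  have hb' : (0 : ℝ) < b := by exact_mod_cast hb
  have hm'R : (0 : ℝ) < m' := by exact_mod_cast hm'
  have hgR : (0 : ℝ) < g := by exact_mod_cast hg0
  have hbmR : (m' : ℝ) = g * b := by exact_mod_cast hbm
  let F : ℝ → ℝ := fun θ => disc c (m * θ + s) * disc c (m' * θ + s)
  have hFmeas : Measurable F := (measurable_disc_comp c m s).mul (measurable_disc_comp c m' s)
  have hper : Function.Periodic F 1 := by
    intro θ
    have h1 : (m : ℝ) * (θ + 1) + s = m * θ + s + (m : ℤ) := by push_cast; ring
    have h2 : (m' : ℝ) * (θ + 1) + s = m' * θ + s + (m' : ℤ) := by push_cast; ring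
    simp only [F, h1, h2, disc_add_intCast]
  set u := m.gcdA m'
  set v := m.gcdB m'
  have huv : (g : ℝ) = m * u + m' * v := by exact_mod_cast Nat.gcd_eq_gcd_ab m m'
  have hshift : ∀ j : ℕ, ∫ θ in (0:ℝ)..1, F θ =
      ∫ θ in (0:ℝ)..1, disc c (m * θ + s + j / b) * disc c (m' * θ + s) := by
    intro j
    have h1 := hper.intervalIntegral_add_eq (j * (u / m') : ℝ) 0
    rw [zero_add] at h1
    rw [← h1]
    have h2 := intervalIntegral.integral_comp_add_right (a := 0) (b := 1) F (j * (u / m') : ℝ)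
    rw [zero_add, add_comm (1 : ℝ)] at h2
    rw [← h2]
    congr 1
    ext θ
    have h3 : (m : ℝ) * (θ + j * (u / m')) + s = m * θ + s + j / b + ((-(j * v) : ℤ) : ℝ) := by
      push_cast
      have : (m : ℝ) * u = g - m' * v := by linarith
      have h4 : (m : ℝ) * (j * (u / m')) = j / b - j * v := by
        calc (m : ℝ) * (j * (u / m')) = j * ((m * u) / m') := by ring
          _ = j * ((g - m' * v) / m') := by rw [this]
          _ = j * (g / m' - v) := by rw [sub_div, mul_div_cancel_left₀ _ hm'R.ne']
          _ = j / b - j * v := by rw [hbmR]; field_simp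
      linarith
    have h4 : (m' : ℝ) * (θ + j * (u / m')) + s = m' * θ + s + ((j * u : ℤ) : ℝ) := by
      push_cast
      field_simp
      ring
    simp only [F, h3, h4, disc_add_intCast]
  have hsum : b * ∫ θ in (0:ℝ)..1, F θ =
      ∫ θ in (0:ℝ)..1, (∑ j ∈ Finset.range b, disc c (m * θ + s + j / b)) *
        disc c (m' * θ + s) := by
    simp_rw [Finset.sum_mul]
    rw [intervalIntegral.integral_finsetSum]
    · rw [← Finset.sum_congr rfl fun j _ => hshift j]
      simp
    · intro j _
      refine intervalIntegrable_of_bounded (C := 1) ?_ ?_ _ _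
      · have := measurable_disc_comp c m (s + j / b)
        simp only [← add_assoc] at this
        exact this.mul (measurable_disc_comp c m' s)
      · intro θ
        rw [abs_mul]
        exact mul_le_one₀ (abs_disc_le _ _) (abs_nonneg _) (abs_disc_le _ _)
  have hbound : |b * ∫ θ in (0:ℝ)..1, F θ| ≤ 1 := by
    rw [hsum]
    have := intervalIntegral.norm_integral_le_of_norm_le_const (a := (0:ℝ)) (b := 1) (C := 1)
      (f := fun θ => (∑ j ∈ Finset.range b, disc c (m * θ + s + j / b)) * disc c (m' * θ + s))
      (fun θ _ => by
        rw [Real.norm_eq_abs, abs_mul]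
        exact mul_le_one₀ (abs_sum_disc_le hb c _) (abs_nonneg _) (abs_disc_le _ _))
    simpa using this
  rw [abs_mul, abs_of_pos hb'] at hbound
  have hgm : (g : ℝ) / m' = 1 / b := by
    rw [hbmR, div_mul_cancel_left₀ hgR.ne', one_div]
  rw [hgm, le_div_iff₀ hb', mul_comm]
  exact hbound

lemma sum_gcd_div_le (M : ℕ) :
    ∑ m ∈ Finset.Icc 1 M, ∑ m' ∈ Finset.Icc 1 M, ((m.gcd m' : ℕ) : ℝ) / m' ≤
      M * (1 + Real.log M) ^ 2 := by
  set S := Finset.Icc 1 M with hS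
  set H : ℝ := ∑ k ∈ S, ((k : ℝ))⁻¹ with hH
  have hH0 : 0 ≤ H := Finset.sum_nonneg fun _ _ => by positivity
  have hHle : H ≤ 1 + Real.log M := by
    have := harmonic_le_one_add_log M
    rw [harmonic_eq_sum_Icc] at this
    push_cast at this
    exact this
  have h1 : ∀ m ∈ S, ∀ m' ∈ S, ((m.gcd m' : ℕ) : ℝ) / m' ≤
      ∑ d ∈ S, (d : ℝ) * ((if d ∣ m then 1 else 0) * if d ∣ m' then ((m' : ℝ))⁻¹ else 0) := by
    intro m hm m' hm'
    rw [hS, Finset.mem_Icc] at hm hm'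
    have hd : m.gcd m' ∈ S := by
      rw [hS, Finset.mem_Icc]
      exact ⟨Nat.gcd_pos_of_pos_left _ (by omega), (Nat.gcd_le_left _ (by omega)).trans hm.2⟩
    refine le_trans (le_of_eq ?_) (Finset.single_le_sum (f := fun d : ℕ => (d : ℝ) *
      ((if d ∣ m then 1 else 0) * if d ∣ m' then ((m' : ℝ))⁻¹ else 0))
      (fun d _ => by positivity) hd)
    simp only [Nat.gcd_dvd_left, Nat.gcd_dvd_right, if_true]
    ring
  refine (Finset.sum_le_sum fun m hm => Finset.sum_le_sum fun m' hm' => h1 m hm m' hm').trans ?_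
  have h2 : ∑ m ∈ S, ∑ m' ∈ S, ∑ d ∈ S,
      (d : ℝ) * ((if d ∣ m then 1 else 0) * if d ∣ m' then ((m' : ℝ))⁻¹ else 0) =
      ∑ d ∈ S, (d : ℝ) * ((∑ m ∈ S, if d ∣ m then 1 else 0) *
        ∑ m' ∈ S, if d ∣ m' then ((m' : ℝ))⁻¹ else 0) := by
    have e1 : ∀ m ∈ S, (∑ m' ∈ S, ∑ d ∈ S,
        (d : ℝ) * ((if d ∣ m then 1 else 0) * if d ∣ m' then ((m' : ℝ))⁻¹ else 0)) =
        ∑ d ∈ S, (d : ℝ) * ((if d ∣ m then 1 else 0) *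
          ∑ m' ∈ S, if d ∣ m' then ((m' : ℝ))⁻¹ else 0) := by
      intro m _
      rw [Finset.sum_comm]
      simp_rw [← Finset.mul_sum]
    rw [Finset.sum_congr rfl e1, Finset.sum_comm]
    simp_rw [← Finset.mul_sum, ← Finset.sum_mul]
  rw [h2]
  have h3 : ∀ d ∈ S, (d : ℝ) * ((∑ m ∈ S, if d ∣ m then 1 else 0) *
      ∑ m' ∈ S, if d ∣ m' then ((m' : ℝ))⁻¹ else 0) ≤ (M * H) * ((d : ℝ))⁻¹ := by
    intro d hd
    rw [hS, Finset.mem_Icc] at hd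
    have hd0 : 0 < d := by omega
    have hd' : (0 : ℝ) < d := by exact_mod_cast hd0
    have himg : S.filter (d ∣ ·) = (Finset.Icc 1 (M / d)).image (d * ·) :=
      Icc_filter_dvd_eq_image hd0 M
    have hinj : Set.InjOn (d * ·) (Finset.Icc 1 (M / d) : Finset ℕ) :=
      fun x _ y _ h => Nat.eq_of_mul_eq_mul_left hd0 h
    have e1 : (∑ m ∈ S, if d ∣ m then (1 : ℝ) else 0) ≤ M / d := by
      rw [← Finset.sum_filter, himg, Finset.sum_image hinj]
      simpa using Nat.cast_div_le (α := ℝ)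
    have e2 : (∑ m' ∈ S, if d ∣ m' then ((m' : ℝ))⁻¹ else 0) ≤ (d : ℝ)⁻¹ * H := by
      rw [← Finset.sum_filter, himg, Finset.sum_image hinj]
      push_cast
      simp_rw [mul_inv]
      rw [← Finset.mul_sum]
      refine mul_le_mul_of_nonneg_left ?_ (by positivity)
      refine Finset.sum_le_sum_of_subset_of_nonneg ?_ fun _ _ _ => by positivity
      exact Finset.Icc_subset_Icc_right (Nat.div_le_self _ _)
    have e3 : 0 ≤ ∑ m' ∈ S, if d ∣ m' then ((m' : ℝ))⁻¹ else 0 :=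
      Finset.sum_nonneg fun _ _ => by positivity
    calc _ ≤ (d : ℝ) * ((M / d) * ((d : ℝ)⁻¹ * H)) := by gcongr
      _ = _ := by field_simp
  refine (Finset.sum_le_sum h3).trans ?_
  rw [← Finset.mul_sum, ← hH]
  calc (M : ℝ) * H * H = M * H ^ 2 := by ring
    _ ≤ _ := by gcongr

lemma integral_sum_disc_sq_le (c s : ℝ) (M : ℕ) :
    ∫ θ in (0:ℝ)..1, (∑ m ∈ Finset.Icc 1 M, disc c (m * θ + s)) ^ 2 ≤
      M * (1 + Real.log M) ^ 2 := by
  simp_rw [sq (Finset.sum _ _), Finset.sum_mul_sum]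
  have hfi : ∀ m m' : ℕ, IntervalIntegrable
      (fun θ : ℝ => disc c (m * θ + s) * disc c (m' * θ + s)) volume 0 1 := by
    intro m m'
    refine intervalIntegrable_of_bounded (C := 1)
      ((measurable_disc_comp c m s).mul (measurable_disc_comp c m' s)) (fun θ => ?_) _ _
    rw [Pi.mul_apply, abs_mul]
    exact mul_le_one₀ (abs_disc_le _ _) (abs_nonneg _) (abs_disc_le _ _)
  rw [intervalIntegral.integral_finsetSum]
  · refine le_trans (Finset.sum_le_sum fun m hm => ?_) (sum_gcd_div_le M)
    rw [intervalIntegral.integral_finsetSum fun m' _ => hfi m m']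
    refine Finset.sum_le_sum fun m' hm' => ?_
    rw [Finset.mem_Icc] at hm'
    exact (le_abs_self _).trans (abs_integral_disc_mul_disc_le c s (by omega))
  · intro m _
    simpa only [Finset.sum_fn] using IntervalIntegrable.sum (Finset.Icc 1 M) fun m' _ => hfi m m'

end Discrepancy

section PairCount
open Set

/-- The number of `n ≤ N` divisible by `D` for which `⌊α n + β⌋` is divisible by `E`. -/
noncomputable def pairCount (β : ℝ) (D E N : ℕ) (α : ℝ) : ℝ :=
  ∑ n ∈ Finset.Icc 1 N, if D ∣ n ∧ (E : ℤ) ∣ ⌊α * n + β⌋ then 1 else 0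

lemma natCast_dvd_floor_iff {E : ℕ} (hE : 0 < E) (y : ℝ) :
    (E : ℤ) ∣ ⌊y⌋ ↔ Int.fract (y / E) < 1 / E := by
  have hE' : (0 : ℝ) < E := by exact_mod_cast hE
  constructor
  · rintro ⟨j, hj⟩
    obtain ⟨h1, h2⟩ := Int.floor_eq_iff.1 hj
    push_cast at h1 h2
    have hE1 : (1 : ℝ) ≤ E := by exact_mod_cast hE
    have h3 : ⌊y / E⌋ = j := by
      rw [Int.floor_eq_iff, le_div_iff₀ hE', div_lt_iff₀ hE']
      constructor <;> linarith
    rw [Int.fract, h3, sub_lt_iff_lt_add, div_lt_iff₀ hE']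
    field_simp
    linarith
  · intro h
    refine ⟨⌊y / E⌋, ?_⟩
    have h1 := Int.floor_le (y / E)
    rw [le_div_iff₀ hE'] at h1
    rw [Int.fract, sub_lt_iff_lt_add, div_lt_iff₀ hE'] at h
    have h2 : (1 / E + (⌊y / E⌋ : ℝ)) * E = 1 + ⌊y / E⌋ * E := by field_simp
    rw [Int.floor_eq_iff]
    push_cast
    constructor <;> linarith

lemma pairCount_eq {D E : ℕ} (hD : 0 < D) (hE : 0 < E) (β α : ℝ) (N : ℕ) :
    pairCount β D E N α = ∑ m ∈ Finset.Icc 1 (N / D), disc (1 / E) (m * (D / E * α) + β / E) +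
      (N / D : ℕ) / E := by
  have hE' : (0 : ℝ) < E := by exact_mod_cast hE
  have hE1 : (1 : ℝ) ≤ E := by exact_mod_cast hE
  have hinj : Set.InjOn (D * ·) (Finset.Icc 1 (N / D) : Finset ℕ) :=
    fun x _ y _ h => Nat.eq_of_mul_eq_mul_left hD h
  rw [pairCount]
  simp_rw [ite_and]
  rw [← Finset.sum_filter, Icc_filter_dvd_eq_image hD, Finset.sum_image hinj]
  have h : ∀ m : ℕ, (if (E : ℤ) ∣ ⌊α * ((D * m : ℕ) : ℝ) + β⌋ then (1 : ℝ) else 0) =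
      disc (1 / E) (m * (D / E * α) + β / E) + 1 / E := by
    intro m
    rw [disc_eq_ite (by positivity) (by rw [div_le_one hE']; exact hE1), sub_add_cancel]
    have : (α * ((D * m : ℕ) : ℝ) + β) / E = m * (D / E * α) + β / E := by
      push_cast; ring
    simp only [natCast_dvd_floor_iff hE, this]
  simp_rw [h, Finset.sum_add_distrib]
  simp
  ring

lemma abs_pairCount_sub_le {D E : ℕ} (hD : 0 < D) (hE : 0 < E) (β α : ℝ) (N : ℕ) :
    |pairCount β D E N α - N / (D * E)| ≤
      |∑ m ∈ Finset.Icc 1 (N / D), disc (1 / E) (m * (D / E * α) + β / E)| + 1 := by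
  have hE' : (0 : ℝ) < E := by exact_mod_cast hE
  have hE1 : (1 : ℝ) ≤ E := by exact_mod_cast hE
  have hD' : (0 : ℝ) < D := by exact_mod_cast hD
  rw [pairCount_eq hD hE, add_sub_assoc]
  refine (abs_add_le _ _).trans (add_le_add_right ?_ _)
  rw [← div_div, ← sub_div, abs_div, abs_of_pos hE', div_le_one hE']
  refine le_trans ?_ hE1
  have h1 : ((N / D : ℕ) : ℝ) ≤ N / D := Nat.cast_div_le
  have h2 : (N : ℝ) / D < (N / D : ℕ) + 1 := by
    rw [div_lt_iff₀ hD']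
    have := Nat.lt_mul_div_succ N hD
    rw [mul_comm] at this
    exact_mod_cast this
  rw [abs_le]
  constructor <;> linarith

lemma abs_sum_disc_comp_le (c s t : ℝ) (M : ℕ) (θ : ℝ) :
    |∑ m ∈ Finset.Icc 1 M, disc c (m * (t * θ) + s)| ≤ M := by
  refine (Finset.abs_sum_le_sum_abs _ _).trans ?_
  refine (Finset.sum_le_sum fun m _ => abs_disc_le _ _).trans ?_
  simp

lemma measurable_sum_disc_comp (c s t : ℝ) (M : ℕ) :
    Measurable fun θ : ℝ => ∑ m ∈ Finset.Icc 1 M, disc c (m * (t * θ) + s) :=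
  Finset.measurable_sum _ fun m _ => (measurable_disc_comp c m s).comp (measurable_id.const_mul t)

lemma integral_sum_disc_comp_sq_le (c s : ℝ) (M : ℕ) {t B : ℝ} (ht : 0 < t) (hB : 0 < B) :
    ∫ α in (0:ℝ)..B, (∑ m ∈ Finset.Icc 1 M, disc c (m * (t * α) + s)) ^ 2 ≤
      (B + t⁻¹) * (M * (1 + Real.log M) ^ 2) := by
  let F : ℝ → ℝ := fun θ => (∑ m ∈ Finset.Icc 1 M, disc c (m * θ + s)) ^ 2
  have hper : Function.Periodic F 1 := by
    intro θ
    have h1 : ∀ m : ℕ, disc c (m * (θ + 1) + s) = disc c (m * θ + s) := by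
      intro m
      rw [← disc_add_intCast c (m * θ + s) m]
      congr 1
      push_cast; ring
    simp only [F, h1]
  have hmeas : Measurable F := by
    have := measurable_sum_disc_comp c s 1 M
    simp only [one_mul] at this
    exact this.pow_const 2
  have hfi : ∀ a b, IntervalIntegrable F volume a b := by
    refine intervalIntegrable_of_bounded hmeas (C := (M : ℝ) ^ 2) fun θ => ?_
    have := abs_sum_disc_comp_le c s 1 M θ
    simp only [one_mul] at this
    simp only [F, abs_pow]
    gcongr
  have h1 := intervalIntegral.integral_comp_mul_left (a := 0) (b := B) F ht.ne'
  have h2 : ∫ θ in (t * 0)..(t * B), F θ ≤ ∫ θ in (0:ℝ)..(⌈t * B⌉ : ℝ), F θ := by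
    rw [mul_zero]
    refine intervalIntegral.integral_mono_interval le_rfl (by positivity) (Int.le_ceil _) ?_
      (hfi _ _)
    exact Eventually.of_forall fun θ => sq_nonneg _
  have h3 := hper.intervalIntegral_add_zsmul_eq ⌈t * B⌉ 0 hfi
  simp only [zero_add, zsmul_eq_mul, mul_one] at h3
  have h4 : (⌈t * B⌉ : ℝ) ≤ t * B + 1 := (Int.ceil_lt_add_one _).le
  have h5 := integral_sum_disc_sq_le c s M
  have h6 : (0 : ℝ) ≤ ∫ θ in (0:ℝ)..1, F θ :=
    intervalIntegral.integral_nonneg zero_le_one fun θ _ => sq_nonneg _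
  change ∫ α in (0:ℝ)..B, F (t * α) ≤ _
  rw [h1, smul_eq_mul]
  calc t⁻¹ * ∫ θ in (t * 0)..(t * B), F θ ≤ t⁻¹ * ((t * B + 1) * (M * (1 + Real.log M) ^ 2)) := by
        gcongr
        refine h2.trans (h3.le.trans ?_)
        exact mul_le_mul h4 h5 h6 (by positivity)
    _ = _ := by field_simp

lemma measurable_pairCount (β : ℝ) (D E N : ℕ) : Measurable (pairCount β D E N) := by
  refine Finset.measurable_sum _ fun n _ => ?_
  have h : Measurable fun α : ℝ => ⌊α * n + β⌋ :=
    Int.measurable_floor.comp ((measurable_id.mul_const _).add_const _)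
  exact (Measurable.of_discrete (f := fun k : ℤ => if D ∣ n ∧ (E : ℤ) ∣ k then (1 : ℝ) else 0)).comp h

lemma abs_pairCount_le (β : ℝ) (D E N : ℕ) (α : ℝ) : |pairCount β D E N α| ≤ N := by
  refine (Finset.abs_sum_le_sum_abs _ _).trans ?_
  refine (Finset.sum_le_sum (g := fun _ => (1 : ℝ)) fun n _ => ?_).trans (by simp)
  split_ifs <;> simp

lemma integrableOn_of_bounded {f : ℝ → ℝ} (hf : Measurable f) {C : ℝ} (hC : ∀ x, |f x| ≤ C)
    {A : Set ℝ} (hA : volume A ≠ ⊤) : IntegrableOn f A :=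
  Measure.integrableOn_of_bounded hA hf.aestronglyMeasurable (M := C)
    (Eventually.of_forall fun x => hC x)

lemma abs_integral_pairCount_sub_le {D E : ℕ} (hD : 0 < D) (hE : 0 < E) (β : ℝ) (N : ℕ) {B T : ℝ}
    (hB : 0 < B) (hT : 0 < T) {A : Set ℝ} (hA : A ⊆ Ioc 0 B) :
    |(∫ α in A, pairCount β D E N α) - volume.real A * (N / (D * E))| ≤
      (B + E) * (N * (1 + Real.log N) ^ 2) / T + B * (T + 1) := by
  have hE' : (0 : ℝ) < E := by exact_mod_cast hE
  have hD' : (0 : ℝ) < D := by exact_mod_cast hD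
  have hD1 : (1 : ℝ) ≤ D := by exact_mod_cast hD
  have hAfin : volume A ≠ ⊤ := ((measure_mono hA).trans_lt (by simp)).ne
  set M := N / D with hM
  let G : ℝ → ℝ := fun α => ∑ m ∈ Finset.Icc 1 M, disc (1 / E) (m * (D / E * α) + β / E)
  have hG : Measurable G := measurable_sum_disc_comp _ _ _ _
  have hGM : ∀ α, |G α| ≤ M := abs_sum_disc_comp_le _ _ _ _
  have hmaj : Measurable fun α => G α ^ 2 / T + (T + 1) :=
    ((hG.pow_const 2).div_const T).add_const _
  have hmajb : ∀ α, |G α ^ 2 / T + (T + 1)| ≤ (M : ℝ) ^ 2 / T + (T + 1) := by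
    intro α
    rw [abs_of_nonneg (by positivity), ← sq_abs]
    have := hGM α
    gcongr
  have hpt : ∀ α, |pairCount β D E N α - N / (D * E)| ≤ G α ^ 2 / T + (T + 1) := by
    intro α
    refine (abs_pairCount_sub_le hD hE β α N).trans ?_
    have h1 : |G α| ≤ G α ^ 2 / T + T := by
      rw [← sq_abs, ← sub_le_iff_le_add, le_div_iff₀ hT]
      nlinarith [sq_nonneg (|G α| - T), sq_nonneg (|G α|), sq_nonneg T]
    change |G α| + 1 ≤ _
    linarith
  have h1 : (∫ α in A, pairCount β D E N α) - volume.real A * (N / (D * E)) =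
      ∫ α in A, (pairCount β D E N α - N / (D * E)) := by
    rw [integral_sub (integrableOn_of_bounded (measurable_pairCount β D E N)
      (abs_pairCount_le β D E N) hAfin) (integrableOn_const hAfin (by simp))]
    simp
  rw [h1]
  have h2 : |∫ α in A, (pairCount β D E N α - N / (D * E))| ≤
      ∫ α in A, (G α ^ 2 / T + (T + 1)) := by
    rw [← Real.norm_eq_abs]
    refine norm_integral_le_of_norm_le (integrableOn_of_bounded hmaj hmajb hAfin) ?_
    exact Eventually.of_forall hpt
  have h3 : ∫ α in A, (G α ^ 2 / T + (T + 1)) ≤ ∫ α in Ioc 0 B, (G α ^ 2 / T + (T + 1)) := by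
    refine setIntegral_mono_set (integrableOn_of_bounded hmaj hmajb (by simp)) ?_
      (LE.le.eventuallyLE hA)
    exact Eventually.of_forall fun α => by positivity
  have h4 : ∫ α in Ioc 0 B, (G α ^ 2 / T + (T + 1)) =
      (∫ α in (0:ℝ)..B, G α ^ 2) / T + B * (T + 1) := by
    rw [← intervalIntegral.integral_of_le hB.le, intervalIntegral.integral_add,
      intervalIntegral.integral_div, intervalIntegral.integral_const]
    · simp
    · refine intervalIntegrable_of_bounded ((hG.pow_const 2).div_const T)
        (C := (M : ℝ) ^ 2 / T) (fun α => ?_) _ _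
      rw [abs_of_nonneg (by positivity), ← sq_abs]
      have := hGM α
      gcongr
    · exact intervalIntegrable_const
  have h5 := integral_sum_disc_comp_sq_le (1 / E) (β / E) M (div_pos hD' hE') hB
  have h6 : (B + ((D : ℝ) / E)⁻¹) * (M * (1 + Real.log M) ^ 2) ≤
      (B + E) * (N * (1 + Real.log N) ^ 2) := by
    have e1 : ((D : ℝ) / E)⁻¹ ≤ E := by
      rw [inv_div]; exact div_le_self hE'.le hD1
    have e2 : (M : ℝ) ≤ N := by exact_mod_cast Nat.div_le_self N D
    have e3 : Real.log M ≤ Real.log N := by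
      rcases Nat.eq_zero_or_pos M with h | h
      · rw [h]; simpa using Real.log_natCast_nonneg N
      · exact Real.log_le_log (by exact_mod_cast h) e2
    have e4 := Real.log_natCast_nonneg M
    gcongr
  refine h2.trans (h3.trans ?_)
  rw [h4]
  have h7 := h5.trans h6
  gcongr

end PairCount

section SieveBound
open Set

/-- The product of two Selberg weights of level `z`. -/
noncomputable def selbergPairWeight (z : ℕ) (x : ℕ × ℕ) : ℝ :=
  selbergWeight z x.1 * selbergWeight z x.2

/-- The upper bound sieve `Λ²` attached to the Selberg weights of level `z`. -/
noncomputable def selbergSq (z n : ℕ) : ℝ :=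
  (∑ d ∈ Finset.Icc 1 z, if d ∣ n then selbergWeight z d else 0) ^ 2

lemma selbergSq_nonneg (z n : ℕ) : 0 ≤ selbergSq z n := sq_nonneg _

lemma selbergSq_prime {z p : ℕ} (hz : 1 ≤ z) (hp : p.Prime) (hzp : z < p) : selbergSq z p = 1 := by
  rw [selbergSq, Finset.sum_eq_single 1]
  · simp [selbergWeight_one hz]
  · intro d hd hd1
    rw [Finset.mem_Icc] at hd
    rw [if_neg]
    intro h
    rcases (Nat.dvd_prime hp).1 h with h | h <;> omega
  · intro h
    exact absurd (Finset.mem_Icc.2 ⟨le_rfl, hz⟩) h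

lemma selbergSq_eq_sum (z n : ℕ) :
    selbergSq z n = ∑ x ∈ Finset.Icc 1 z ×ˢ Finset.Icc 1 z,
      selbergPairWeight z x * if x.1.lcm x.2 ∣ n then 1 else 0 := by
  rw [selbergSq, sq, Finset.sum_mul_sum, ← Finset.sum_product']
  refine Finset.sum_congr rfl fun x _ => ?_
  rw [selbergPairWeight]
  by_cases h1 : x.1 ∣ n <;> by_cases h2 : x.2 ∣ n <;> simp [Nat.lcm_dvd_iff, h1, h2]

lemma indicator_primeSlopes_le {z : ℕ} (hz : 1 ≤ z) {b₁ α : ℝ} (hb : 0 < b₁) (hα : b₁ ≤ α) (β : ℝ)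
    {p : ℕ} (hp : p.Prime) :
    (primeSlopes β p).indicator (1 : ℝ → ℝ) α ≤
      (if (p : ℝ) ≤ z + (z + 1 + |β|) / b₁ then 1 else 0) +
        selbergSq z p * selbergSq z ⌊α * p + β⌋.natAbs := by
  have h0 : 0 ≤ selbergSq z p * selbergSq z ⌊α * p + β⌋.natAbs :=
    mul_nonneg (selbergSq_nonneg _ _) (selbergSq_nonneg _ _)
  split_ifs with h
  · have : (primeSlopes β p).indicator (1 : ℝ → ℝ) α ≤ 1 :=
      indicator_le_self' (fun _ _ => zero_le_one) α
    linarith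
  · rw [zero_add]
    by_cases hα' : α ∈ primeSlopes β p
    · rw [indicator_of_mem hα', Pi.one_apply]
      push Not at h
      have hq0 : 0 ≤ (z + 1 + |β|) / b₁ := by positivity
      have hzp : z < p := by
        have : (z : ℝ) < p := by linarith
        exact_mod_cast this
      have h1 : (z : ℝ) + 1 + |β| < p * b₁ := by
        rw [← div_lt_iff₀ hb]
        linarith [(Nat.cast_nonneg z : (0:ℝ) ≤ z)]
      have h2 : (p : ℝ) * b₁ ≤ α * p := by
        rw [mul_comm α]; gcongr
      have h3 : ((z + 1 : ℕ) : ℤ) ≤ ⌊α * p + β⌋ := by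
        rw [Int.le_floor]; push_cast
        linarith [neg_abs_le β]
      have hprime : Nat.Prime ⌊α * p + β⌋.natAbs := by
        have h4 : ⌊α * p + β⌋.natAbs = ⌊α * p + β⌋.toNat := by omega
        rw [h4]; exact hα'
      rw [selbergSq_prime hz hp hzp, selbergSq_prime hz hprime (by omega), one_mul]
    · rw [indicator_of_notMem hα']
      exact h0

lemma piStar_le {z : ℕ} (hz : 1 ≤ z) {b₁ α : ℝ} (hb : 0 < b₁) (hα : b₁ ≤ α) (β : ℝ) (N : ℕ) :
    (piStar α β N : ℝ) ≤ (z + (z + 1 + |β|) / b₁) +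
      ∑ x ∈ Finset.Icc 1 z ×ˢ Finset.Icc 1 z, ∑ y ∈ Finset.Icc 1 z ×ˢ Finset.Icc 1 z,
        selbergPairWeight z x * selbergPairWeight z y *
          pairCount β (x.1.lcm x.2) (y.1.lcm y.2) N α := by
  set K := z + (z + 1 + |β|) / b₁ with hK
  have hK0 : 0 ≤ K := by positivity
  have h1 : (piStar α β N : ℝ) ≤ ∑ n ∈ Finset.Icc 1 N,
      ((if (n : ℝ) ≤ K then 1 else 0) + selbergSq z n * selbergSq z ⌊α * n + β⌋.natAbs) := by
    rw [piStar_natCast]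
    have hsub : (Finset.Ioc 0 N).filter Nat.Prime ⊆ Finset.Icc 1 N := by
      intro p hp
      simp only [Finset.mem_filter, Finset.mem_Ioc, Finset.mem_Icc] at hp ⊢
      omega
    refine le_trans (Finset.sum_le_sum fun p hp => ?_)
      (Finset.sum_le_sum_of_subset_of_nonneg hsub fun n _ _ => ?_)
    · exact indicator_primeSlopes_le hz hb hα β (Finset.mem_filter.1 hp).2
    · exact add_nonneg (by positivity) (mul_nonneg (selbergSq_nonneg _ _) (selbergSq_nonneg _ _))
  have h2 : ∑ n ∈ Finset.Icc 1 N, (if (n : ℝ) ≤ K then (1 : ℝ) else 0) ≤ K := by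
    rw [← Finset.sum_filter]
    have : (Finset.Icc 1 N).filter (fun n : ℕ => (n : ℝ) ≤ K) ⊆ Finset.Icc 1 ⌊K⌋₊ := by
      intro n hn
      simp only [Finset.mem_filter, Finset.mem_Icc] at hn ⊢
      exact ⟨hn.1.1, (Nat.le_floor_iff hK0).2 hn.2⟩
    have h3 := Finset.card_le_card this
    simp only [Finset.sum_const, nsmul_eq_mul, mul_one]
    rw [Nat.card_Icc, Nat.add_sub_cancel] at h3
    exact (Nat.cast_le.2 h3).trans (Nat.floor_le hK0)
  rw [Finset.sum_add_distrib] at h1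
  refine h1.trans (add_le_add h2 (le_of_eq ?_))
  have h3 : ∀ n ∈ Finset.Icc 1 N, selbergSq z n * selbergSq z ⌊α * n + β⌋.natAbs =
      ∑ x ∈ Finset.Icc 1 z ×ˢ Finset.Icc 1 z, ∑ y ∈ Finset.Icc 1 z ×ˢ Finset.Icc 1 z,
        selbergPairWeight z x * selbergPairWeight z y *
          if x.1.lcm x.2 ∣ n ∧ ((y.1.lcm y.2 : ℕ) : ℤ) ∣ ⌊α * n + β⌋ then 1 else 0 := by
    intro n _
    rw [selbergSq_eq_sum, selbergSq_eq_sum, Finset.sum_mul_sum]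
    refine Finset.sum_congr rfl fun x _ => Finset.sum_congr rfl fun y _ => ?_
    simp only [Int.natCast_dvd]
    by_cases e1 : x.1.lcm x.2 ∣ n <;> by_cases e2 : y.1.lcm y.2 ∣ ⌊α * n + β⌋.natAbs <;>
      simp [e1, e2]
  rw [Finset.sum_congr rfl h3, Finset.sum_comm]
  refine Finset.sum_congr rfl fun x _ => ?_
  rw [Finset.sum_comm]
  refine Finset.sum_congr rfl fun y _ => ?_
  rw [pairCount, Finset.mul_sum]

lemma abs_selbergPairWeight_le {z : ℕ} (hz : 1 ≤ z) {x : ℕ × ℕ}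
    (hx : x ∈ Finset.Icc 1 z ×ˢ Finset.Icc 1 z) : |selbergPairWeight z x| ≤ (z : ℝ) ^ 2 := by
  rw [Finset.mem_product, Finset.mem_Icc, Finset.mem_Icc] at hx
  rw [selbergPairWeight, abs_mul, sq]
  have h1 : (x.1 : ℝ) ≤ z := by exact_mod_cast hx.1.2
  have h2 : (x.2 : ℝ) ≤ z := by exact_mod_cast hx.2.2
  exact mul_le_mul ((abs_selbergWeight_le hz _).trans h1) ((abs_selbergWeight_le hz _).trans h2)
    (abs_nonneg _) (by positivity)

/-- Upper bound sieve for `π*`, averaged over an arbitrary set of slopes. -/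
lemma integral_piStar_le {z : ℕ} (hz : 1 ≤ z) {b₁ B T : ℝ} (hb : 0 < b₁) (hB : 0 < B) (hT : 0 < T)
    (β : ℝ) (N : ℕ) {A : Set ℝ} (hA : MeasurableSet A) (hAb : A ⊆ Icc b₁ B) :
    ∫ α in A, (piStar α β N : ℝ) ≤ B * (z + (z + 1 + |β|) / b₁) +
      volume.real A * (N / selbergMass z ^ 2) +
      z ^ 8 * ((B + z ^ 2) * (N * (1 + Real.log N) ^ 2) / T + B * (T + 1)) := by
  set K := z + (z + 1 + |β|) / b₁ with hK
  have hK0 : 0 ≤ K := by positivity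
  set Q := Finset.Icc 1 z ×ˢ Finset.Icc 1 z with hQ
  set R := (B + z ^ 2) * (N * (1 + Real.log N) ^ 2) / T + B * (T + 1) with hR
  have hA0 : A ⊆ Ioc 0 B := fun α hα => ⟨hb.trans_le (hAb hα).1, (hAb hα).2⟩
  have hAfin : volume A ≠ ⊤ := ((measure_mono hA0).trans_lt (by simp)).ne
  have hAB : volume.real A ≤ B := by
    have := measureReal_mono (μ := volume) hA0 (by simp)
    simpa [hB.le] using this
  have hpc : ∀ x y : ℕ × ℕ, IntegrableOn (fun α => selbergPairWeight z x * selbergPairWeight z y *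
      pairCount β (x.1.lcm x.2) (y.1.lcm y.2) N α) A := fun x y =>
    (integrableOn_of_bounded (measurable_pairCount β _ _ N) (abs_pairCount_le β _ _ N) hAfin).const_mul _
  have hpcx : ∀ x : ℕ × ℕ, IntegrableOn (fun α => ∑ y ∈ Q, selbergPairWeight z x *
      selbergPairWeight z y * pairCount β (x.1.lcm x.2) (y.1.lcm y.2) N α) A := fun x =>
    integrable_finsetSum _ fun y _ => hpc x y
  have hpcxy : IntegrableOn (fun α => ∑ x ∈ Q, ∑ y ∈ Q, selbergPairWeight z x *
      selbergPairWeight z y * pairCount β (x.1.lcm x.2) (y.1.lcm y.2) N α) A :=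
    integrable_finsetSum _ fun x _ => hpcx x
  have hKi : Integrable (fun _ : ℝ => K) (volume.restrict A) := integrableOn_const hAfin (by simp)
  have hmaj := hKi.add hpcxy
  have h1 : ∫ α in A, (piStar α β N : ℝ) ≤ ∫ α in A, (K + ∑ x ∈ Q, ∑ y ∈ Q,
      selbergPairWeight z x * selbergPairWeight z y *
        pairCount β (x.1.lcm x.2) (y.1.lcm y.2) N α) := by
    refine integral_mono_of_nonneg (Eventually.of_forall fun α => Nat.cast_nonneg _) hmaj ?_
    filter_upwards [ae_restrict_mem hA] with α hα
    exact piStar_le hz hb (hAb hα).1 β N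
  refine h1.trans ?_
  rw [integral_add hKi hpcxy, integral_finsetSum _ fun x _ => hpcx x]
  have hlcm : ∀ x ∈ Q, 0 < x.1.lcm x.2 ∧ ((x.1.lcm x.2 : ℕ) : ℝ) ≤ (z : ℝ) ^ 2 := by
    intro x hx
    rw [hQ, Finset.mem_product, Finset.mem_Icc, Finset.mem_Icc] at hx
    refine ⟨Nat.lcm_pos hx.1.1 hx.2.1, ?_⟩
    have : x.1.lcm x.2 ≤ z ^ 2 := (Nat.le_of_dvd (Nat.mul_pos hx.1.1 hx.2.1)
      (Nat.lcm_dvd_mul _ _)).trans (by rw [sq]; exact Nat.mul_le_mul hx.1.2 hx.2.2)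
    exact_mod_cast this
  have h2 : ∀ x ∈ Q, ∀ y ∈ Q, ∫ α in A, selbergPairWeight z x * selbergPairWeight z y *
      pairCount β (x.1.lcm x.2) (y.1.lcm y.2) N α ≤
      volume.real A * N * ((selbergPairWeight z x / (x.1.lcm x.2 : ℕ)) *
        (selbergPairWeight z y / (y.1.lcm y.2 : ℕ))) + (z : ℝ) ^ 4 * R := by
    intro x hx y hy
    obtain ⟨hx0, hx1⟩ := hlcm x hx
    obtain ⟨hy0, hy1⟩ := hlcm y hy
    rw [integral_const_mul]
    have e1 := abs_integral_pairCount_sub_le hx0 hy0 β N hB hT hA0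
    set I := ∫ α in A, pairCount β (x.1.lcm x.2) (y.1.lcm y.2) N α
    have e2 : (B + (y.1.lcm y.2 : ℕ)) * (N * (1 + Real.log N) ^ 2) / T + B * (T + 1) ≤ R := by
      rw [hR]; gcongr
    have e3 : |selbergPairWeight z x * selbergPairWeight z y| ≤ (z : ℝ) ^ 4 := by
      rw [abs_mul]
      calc _ ≤ (z : ℝ) ^ 2 * (z : ℝ) ^ 2 := mul_le_mul (abs_selbergPairWeight_le hz hx)
            (abs_selbergPairWeight_le hz hy) (abs_nonneg _) (by positivity)
        _ = _ := by ring
    have e4 : selbergPairWeight z x * selbergPairWeight z y *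
        (I - volume.real A * (N / ((x.1.lcm x.2 : ℕ) * (y.1.lcm y.2 : ℕ)))) ≤ (z : ℝ) ^ 4 * R := by
      refine (le_abs_self _).trans ?_
      rw [abs_mul]
      exact mul_le_mul e3 (e1.trans e2) (abs_nonneg _) (by positivity)
    have e5 : volume.real A * N * ((selbergPairWeight z x / (x.1.lcm x.2 : ℕ)) *
        (selbergPairWeight z y / (y.1.lcm y.2 : ℕ))) =
        selbergPairWeight z x * selbergPairWeight z y *
          (volume.real A * (N / ((x.1.lcm x.2 : ℕ) * (y.1.lcm y.2 : ℕ)))) := by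
      have : ((x.1.lcm x.2 : ℕ) : ℝ) ≠ 0 := by exact_mod_cast hx0.ne'
      have : ((y.1.lcm y.2 : ℕ) : ℝ) ≠ 0 := by exact_mod_cast hy0.ne'
      field_simp
    rw [e5]
    linarith
  have h3 : ∑ x ∈ Q, ∫ α in A, ∑ y ∈ Q, selbergPairWeight z x * selbergPairWeight z y *
      pairCount β (x.1.lcm x.2) (y.1.lcm y.2) N α ≤
      ∑ x ∈ Q, ∑ y ∈ Q, (volume.real A * N * ((selbergPairWeight z x / (x.1.lcm x.2 : ℕ)) *
        (selbergPairWeight z y / (y.1.lcm y.2 : ℕ))) + (z : ℝ) ^ 4 * R) := by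
    refine Finset.sum_le_sum fun x hx => ?_
    rw [integral_finsetSum _ fun y _ => hpc x y]
    exact Finset.sum_le_sum fun y hy => h2 x hx y hy
  have h4 : ∑ x ∈ Q, selbergPairWeight z x / (x.1.lcm x.2 : ℕ) = 1 / selbergMass z := by
    rw [← sum_selbergWeight_div_lcm hz, hQ, Finset.sum_product]
    rfl
  simp_rw [Finset.sum_add_distrib, ← Finset.mul_sum, ← Finset.sum_mul] at h3
  rw [h4] at h3
  have hcard : (Q.card : ℝ) = (z : ℝ) ^ 2 := by
    rw [hQ, Finset.card_product, Nat.card_Icc]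
    push_cast [Nat.add_sub_cancel]
    ring
  simp only [Finset.sum_const, nsmul_eq_mul, hcard] at h3
  have h5 : ∫ _ in A, K = volume.real A * K := by simp
  rw [h5]
  have h6 : volume.real A * K ≤ B * K := by gcongr
  have h7 : volume.real A * N * (1 / selbergMass z * (1 / selbergMass z)) =
      volume.real A * (N / selbergMass z ^ 2) := by ring
  rw [h7] at h3
  have h8 : (z : ℝ) ^ 4 * ((z : ℝ) ^ 2 * ((z : ℝ) ^ 2 * R)) = z ^ 8 * R := by ring
  rw [h8] at h3
  linarith

end SieveBound

section SieveAsymptotics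
open Set Topology

lemma integral_piStar_le_of_pow {b₁ B ε u : ℝ} (hb : 0 < b₁) (hB : 0 < B) (hε : 0 < ε) (β : ℝ)
    (hu : 2 ≤ u)
    (huD : (B * (1 + (2 + |β|) / b₁) + 101 ^ 2 * (B + 1) + 2 * B) * 100 ^ 2 ≤ ε * u)
    {N : ℕ} (hN : (N : ℝ) = u ^ 100) {A : Set ℝ} (hA : MeasurableSet A) (hAb : A ⊆ Icc b₁ B) :
    ∫ α in A, (piStar α β N : ℝ) ≤
      (160000 * volume.real A + ε) * (N / Real.log N ^ 2) := by
  have hu0 : 0 < u := by linarith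
  have hu1 : 1 ≤ u := by linarith
  set z := ⌊u⌋₊ with hz
  have hz2 : 2 ≤ z := Nat.le_floor (by exact_mod_cast hu)
  have hzu : (z : ℝ) ≤ u := Nat.floor_le hu0.le
  have huz : u < z + 1 := Nat.lt_floor_add_one u
  have hz2' : (2 : ℝ) ≤ z := by exact_mod_cast hz2
  have hlogN : Real.log N = 100 * Real.log u := by
    rw [hN, Real.log_pow]; norm_num
  have hlogu : 0 < Real.log u := Real.log_pos (by linarith)
  have hlogu' : Real.log u ≤ u := (Real.log_le_sub_one_of_pos hu0).trans (by linarith)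
  have hlogz : Real.log u ≤ 2 * Real.log z := by
    have : u ≤ (z : ℝ) ^ 2 := by nlinarith
    calc Real.log u ≤ Real.log ((z : ℝ) ^ 2) := Real.log_le_log hu0 this
      _ = 2 * Real.log z := by rw [Real.log_pow]; norm_num
  have hmass : Real.log N / 400 ≤ selbergMass z := by
    have := log_le_selbergMass (z := z) (by omega)
    rw [hlogN]; linarith
  have hlogN0 : 0 < Real.log N := by rw [hlogN]; positivity
  have hN0 : (0 : ℝ) < N := by rw [hN]; positivity
  have hmain : (N : ℝ) / selbergMass z ^ 2 ≤ 160000 * (N / Real.log N ^ 2) := by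
    calc (N : ℝ) / selbergMass z ^ 2 ≤ N / (Real.log N / 400) ^ 2 := by gcongr
      _ = 160000 * (N / Real.log N ^ 2) := by field_simp; norm_num
  have herr : B * (z + (z + 1 + |β|) / b₁) + z ^ 8 * ((B + z ^ 2) *
      (N * (1 + Real.log N) ^ 2) / u ^ 75 + B * (u ^ 75 + 1)) ≤ ε * (N / Real.log N ^ 2) := by
    have e1 : B * (z + (z + 1 + |β|) / b₁) ≤ B * (1 + (2 + |β|) / b₁) * u ^ 83 := by
      have : (z : ℝ) + (z + 1 + |β|) / b₁ ≤ (1 + (2 + |β|) / b₁) * u := by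
        have h : (z + 1 + |β|) / b₁ ≤ (2 + |β|) * u / b₁ := by
          gcongr
          nlinarith [abs_nonneg β]
        calc (z : ℝ) + (z + 1 + |β|) / b₁ ≤ u + (2 + |β|) * u / b₁ := add_le_add hzu h
          _ = _ := by ring
      calc B * (z + (z + 1 + |β|) / b₁) ≤ B * ((1 + (2 + |β|) / b₁) * u) := by gcongr
        _ = B * (1 + (2 + |β|) / b₁) * u := by ring
        _ ≤ _ := by
          gcongr
          exact le_self_pow₀ hu1 (by norm_num)
    have e2 : (z : ℝ) ^ 8 * ((B + z ^ 2) * (N * (1 + Real.log N) ^ 2) / u ^ 75) ≤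
        101 ^ 2 * (B + 1) * u ^ 83 := by
      have h1 : B + (z : ℝ) ^ 2 ≤ (B + 1) * u ^ 2 := by
        have : (z : ℝ) ^ 2 ≤ u ^ 2 := by gcongr
        nlinarith [one_le_pow₀ hu1 (n := 2)]
      have h2 : 1 + Real.log N ≤ 101 * u := by rw [hlogN]; linarith
      calc (z : ℝ) ^ 8 * ((B + z ^ 2) * (N * (1 + Real.log N) ^ 2) / u ^ 75)
          ≤ u ^ 8 * ((B + 1) * u ^ 2 * (u ^ 100 * (101 * u) ^ 2) / u ^ 75) := by
            rw [← hN]; gcongr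
        _ = 101 ^ 2 * (B + 1) * u ^ 37 := by field_simp
        _ ≤ _ := by gcongr; norm_num
    have e3 : (z : ℝ) ^ 8 * (B * (u ^ 75 + 1)) ≤ 2 * B * u ^ 83 := by
      have : 1 ≤ u ^ 75 := one_le_pow₀ hu1
      calc (z : ℝ) ^ 8 * (B * (u ^ 75 + 1)) ≤ u ^ 8 * (B * (u ^ 75 + u ^ 75)) := by gcongr
        _ = _ := by ring
    have e4 : (B * (1 + (2 + |β|) / b₁) + 101 ^ 2 * (B + 1) + 2 * B) * u ^ 83 ≤
        ε * (N / Real.log N ^ 2) := by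
      have h1 : ε * u ^ 98 / 100 ^ 2 ≤ ε * (N / Real.log N ^ 2) := by
        have : Real.log N ≤ 100 * u := by rw [hlogN]; linarith
        calc ε * u ^ 98 / 100 ^ 2 = ε * (u ^ 100 / (100 * u) ^ 2) := by field_simp
          _ ≤ _ := by rw [← hN]; gcongr
      refine le_trans ?_ h1
      rw [le_div_iff₀ (by norm_num)]
      calc _ = (B * (1 + (2 + |β|) / b₁) + 101 ^ 2 * (B + 1) + 2 * B) * 100 ^ 2 * u ^ 83 := by ring
        _ ≤ ε * u * u ^ 83 := by gcongr
        _ = ε * u ^ 84 := by ring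
        _ ≤ ε * u ^ 98 := by gcongr; norm_num
    linarith
  have := integral_piStar_le (z := z) (by omega) hb hB (T := u ^ 75) (by positivity) β N hA hAb
  have hv : volume.real A * (N / selbergMass z ^ 2) ≤
      volume.real A * (160000 * (N / Real.log N ^ 2)) := by gcongr
  linarith

lemma eventually_integral_piStar_le {b₁ B ε : ℝ} (hb : 0 < b₁) (hB : 0 < B) (hε : 0 < ε) (β : ℝ) :
    ∀ᶠ N : ℕ in atTop, ∀ A : Set ℝ, MeasurableSet A → A ⊆ Icc b₁ B →
      ∫ α in A, (piStar α β N : ℝ) ≤ (160000 * volume.real A + ε) * (N / Real.log N ^ 2) := by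
  have hu : Tendsto (fun N : ℕ => (N : ℝ) ^ (1 / 100 : ℝ)) atTop atTop :=
    (tendsto_rpow_atTop (by norm_num)).comp tendsto_natCast_atTop_atTop
  filter_upwards [hu.eventually_ge_atTop 2, hu.eventually_ge_atTop
    ((B * (1 + (2 + |β|) / b₁) + 101 ^ 2 * (B + 1) + 2 * B) * 100 ^ 2 / ε)] with N h1 h2 A hA hAb
  refine integral_piStar_le_of_pow hb hB hε β h1 ?_ ?_ hA hAb
  · rwa [div_le_iff₀' hε] at h2
  · rw [← Real.rpow_natCast, ← Real.rpow_mul (Nat.cast_nonneg N)]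
    norm_num

end SieveAsymptotics

section Density
open Set Topology

lemma exists_Icc_measureReal_diff_le {E : Set ℝ} (hE : MeasurableSet E) (h0 : volume E ≠ 0)
    {b₁ b₂ : ℝ} (hEb : E ⊆ Ioo b₁ b₂) {ε : ℝ} (hε : 0 < ε) :
    ∃ a b, a < b ∧ Icc a b ⊆ Ioo b₁ b₂ ∧ volume.real (Icc a b \ E) ≤ ε * (b - a) := by
  have hne : (ae (volume.restrict E)).NeBot := ae_neBot.2 (Measure.restrict_eq_zero.not.2 h0)
  obtain ⟨x, hx, hxE⟩ := ((Besicovitch.ae_tendsto_measure_inter_div volume E).and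
    (ae_restrict_mem hE)).exists
  have h1 := ((ENNReal.tendsto_toReal ENNReal.one_ne_top).comp hx).eventually
    (lt_mem_nhds (show 1 - ε < (1 : ENNReal).toReal by simp [hε]))
  have h2 : ∀ᶠ r : ℝ in 𝓝[>] 0, Metric.closedBall x r ⊆ Ioo b₁ b₂ :=
    (eventually_closedBall_subset (isOpen_Ioo.mem_nhds (hEb hxE))).filter_mono
      nhdsWithin_le_nhds
  obtain ⟨r, ⟨hr1, hr2⟩, hr0⟩ := ((h1.and h2).and self_mem_nhdsWithin).exists
  have hvol : volume.real (Metric.closedBall x r) = 2 * r := by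
    rw [measureReal_def, Real.volume_closedBall, ENNReal.toReal_ofReal (by linarith)]
  rw [Function.comp_apply, ENNReal.toReal_div, ← measureReal_def, ← measureReal_def, hvol,
    lt_div_iff₀ (by linarith), inter_comm] at hr1
  have h3 := measureReal_sdiff_add_inter (μ := volume) (s := Metric.closedBall x r) hE
    (by rw [Real.volume_closedBall]; exact ENNReal.ofReal_ne_top)
  rw [Real.closedBall_eq_Icc] at *
  refine ⟨x - r, x + r, by linarith, hr2, ?_⟩
  nlinarith

lemma measurable_piStar_natCast (β : ℝ) (N : ℕ) : Measurable fun α => (piStar α β N : ℝ) := by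
  simp_rw [piStar_natCast]
  exact Finset.measurable_fun_sum _ fun p _ =>
    measurable_one.indicator (measurableSet_primeSlopes β p)

lemma piStar_natCast_le (α β : ℝ) (N : ℕ) : |(piStar α β N : ℝ)| ≤ N := by
  rw [Nat.abs_cast, piStar_natCast]
  refine (Finset.sum_le_card_nsmul _ _ 1 fun p _ =>
    indicator_le_self' (fun _ _ => zero_le_one) α).trans ?_
  have := Finset.card_filter_le (Finset.Ioc 0 N) Nat.Prime
  rw [Nat.card_Ioc, Nat.sub_zero] at this
  simpa using this

/-- A set of slopes on which `π*` stays uniformly below its average order is null. -/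
lemma volume_eq_zero_of_piStar_le {β b₁ b₂ δ : ℝ} (hb : 0 < b₁) (hδ : 0 < δ) (hδ1 : δ ≤ 1)
    {E : Set ℝ} (hE : MeasurableSet E) (hEb : E ⊆ Ioo b₁ b₂) (k : ℕ)
    (hle : ∀ α ∈ E, ∀ N : ℕ, k ≤ N → (piStar α β N : ℝ) * Real.log N ^ 2 / N ≤ 1 - δ) :
    volume E = 0 := by
  by_contra h0
  set ε := δ / 200000 with hε
  have hε0 : 0 < ε := by positivity
  obtain ⟨a, b, hab, hsub, hdiff⟩ := exists_Icc_measureReal_diff_le hE h0 hEb hε0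
  have ha : b₁ < a := (hsub (left_mem_Icc.2 hab.le)).1
  have hbb : b < b₂ := (hsub (right_mem_Icc.2 hab.le)).2
  have hba : 0 < b - a := sub_pos.2 hab
  have hlow := eventually_le_integral_piStar (hb.trans ha) hab β
    (show (1 - ε) * (b - a) < b - a by nlinarith)
  have hupp := eventually_integral_piStar_le hb (show 0 < b by linarith)
    (show 0 < ε * (b - a) by positivity) β
  obtain ⟨N, hN1, hN2, hN3, hN4⟩ := (hlow.and (hupp.and
    ((eventually_ge_atTop k).and (eventually_ge_atTop 2)))).exists
  have hN : (0 : ℝ) < N := by exact_mod_cast (by omega : 0 < N)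
  have hlog : 0 < Real.log N := Real.log_pos (by exact_mod_cast (by omega : 1 < N))
  set M := (N : ℝ) / Real.log N ^ 2 with hM
  have hM0 : 0 < M := by positivity
  have hfi : ∀ A ⊆ Icc a b, IntegrableOn (fun α => (piStar α β N : ℝ)) A := fun A hA =>
    integrableOn_of_bounded (measurable_piStar_natCast β N) (piStar_natCast_le · β N)
      ((measure_mono hA).trans_lt (by simp)).ne
  have h1 := hN2 (Icc a b \ E) (measurableSet_Icc.diff hE)
    (sdiff_subset.trans (Icc_subset_Icc_left ha.le))
  have h2 : ∫ α in Icc a b ∩ E, (piStar α β N : ℝ) ≤ (1 - δ) * M * (b - a) := by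
    have hfin : volume (Icc a b ∩ E) ≠ ⊤ := ((measure_mono inter_subset_left).trans_lt (by simp)).ne
    calc ∫ α in Icc a b ∩ E, (piStar α β N : ℝ) ≤ ∫ α in Icc a b ∩ E, (1 - δ) * M := by
          refine setIntegral_mono_on (hfi _ inter_subset_left) (integrableOn_const hfin)
            (measurableSet_Icc.inter hE) fun α hα => ?_
          have := hle α hα.2 N hN3
          rw [div_le_iff₀ hN] at this
          rw [hM, ← mul_div_assoc, le_div_iff₀ (by positivity)]
          exact this
      _ = (1 - δ) * M * volume.real (Icc a b ∩ E) := by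
          rw [setIntegral_const, smul_eq_mul, mul_comm]
      _ ≤ (1 - δ) * M * (b - a) := by
          have : volume.real (Icc a b ∩ E) ≤ b - a := by
            have := measureReal_mono (μ := volume) (inter_subset_left (s := Icc a b) (t := E))
              (by simp)
            rwa [Real.volume_real_Icc_of_le hab.le] at this
          have : 0 ≤ 1 - δ := by linarith
          gcongr
  rw [← integral_inter_add_sdiff hE (hfi _ le_rfl), mul_div_assoc, ← hM] at hN1
  have h3 : (160000 * volume.real (Icc a b \ E) + ε * (b - a)) * M ≤
      160001 * ε * (b - a) * M := by
    gcongr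
    linarith
  have h4 : 0 < (b - a) * M := by positivity
  have h5 : δ = 200000 * ε := by rw [hε]; ring
  nlinarith [mul_pos hε0 h4]

end Density

theorem measure_bad_limsup_set_zero
    (β : ℝ) (n : ℕ) (hn : 2 ≤ n) (b₁ b₂ : ℝ) (hb₁ : 0 < b₁) (hb : b₁ < b₂) :
    volume {α ∈ Set.Ioo b₁ b₂ |
        Filter.limsup
            (fun x : ℝ => (((piStar α β x : ℝ) * (Real.log x) ^ 2 / x : ℝ) : EReal))
            Filter.atTop ≤ ((1 - 1 / n : ℝ) : EReal)} = 0 := by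
  have hn0 : (0 : ℝ) < n := by exact_mod_cast (by omega : 0 < n)
  set δ : ℝ := 1 / (2 * n) with hδ
  have hδ0 : 0 < δ := by positivity
  have hn1 : (1 : ℝ) ≤ n := by exact_mod_cast (by omega : 1 ≤ n)
  have hδ1 : δ ≤ 1 := by
    rw [hδ, div_le_one (by positivity)]
    linarith
  have hlt : 1 - 1 / (n : ℝ) < 1 - δ := by
    have : 1 / (n : ℝ) = 2 * δ := by rw [hδ]; field_simp
    linarith
  have hzero : volume (⋃ k : ℕ, {α ∈ Set.Ioo b₁ b₂ | ∀ N : ℕ, k ≤ N →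
      (piStar α β N : ℝ) * Real.log N ^ 2 / N ≤ 1 - δ}) = 0 := by
    refine measure_iUnion_null fun k => volume_eq_zero_of_piStar_le hb₁ hδ0 hδ1 ?_
      (fun α hα => hα.1) k fun α hα => hα.2
    have : {α ∈ Set.Ioo b₁ b₂ | ∀ N : ℕ, k ≤ N →
          (piStar α β N : ℝ) * Real.log N ^ 2 / N ≤ 1 - δ} = Set.Ioo b₁ b₂ ∩
        ⋂ N : ℕ, ⋂ _ : k ≤ N, {α | (piStar α β N : ℝ) * Real.log N ^ 2 / N ≤ 1 - δ} := by
      ext; simp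
    rw [this]
    exact measurableSet_Ioo.inter <| MeasurableSet.iInter fun N => MeasurableSet.iInter fun _ =>
      measurableSet_le (((measurable_piStar_natCast β N).mul_const _).div_const _) measurable_const
  refine measure_mono_null (fun α hα => ?_) hzero
  have hev := tendsto_natCast_atTop_atTop.eventually
    (eventually_lt_of_limsup_lt (hα.2.trans_lt (EReal.coe_lt_coe_iff.2 hlt)))
  obtain ⟨k, hk⟩ := eventually_atTop.1 hev
  exact Set.mem_iUnion.2 ⟨k, hα.1, fun N hN => (EReal.coe_lt_coe_iff.1 (hk N hN)).le⟩
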